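/- Let R be a commutative ring of finite Krull dimension d and A = R[Y, Y^{-1}] the Laurent polynomial ring in one variable over R. Let P be a finitely generated projective A-module of constant rank r ≥ d+1 which satisfies property Ω(R). Then E(A ⊕ P) acts transitively on Um(A ⊕ P). -/

import Mathlib

open Polynomial

/-- An element `m` of an `A`-module `M` is unimodular if some linear functional sends it to `1`. -/
def IsUnimodular (A : Type*) [CommRing A] (M : Type*) [AddCommGroup M] [Module A M]
    (m : M) : Prop :=
  ∃ φ : M →ₗ[A] A, φ m = 1

/-- `E(M)`: the subgroup of `Aut_A(M)` generated by transvections, i.e. automorphisms of the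
form `q ↦ q + φ(q) • p` with `φ(p) = 0` and `p` unimodular or `φ` unimodular. -/
def TransvectionGroup (A : Type*) [CommRing A] (M : Type*) [AddCommGroup M] [Module A M] :
    Subgroup (M ≃ₗ[A] M) :=
  Subgroup.closure {σ : M ≃ₗ[A] M | ∃ (p : M) (φ : M →ₗ[A] A), φ p = 0 ∧
    (IsUnimodular A M p ∨ IsUnimodular A (M →ₗ[A] A) φ) ∧ ∀ q : M, σ q = q + φ q • p}

/-- A projective module has constant rank `r` if its localization at every prime is free of
rank `r`. -/
def HasConstantRank (A : Type*) [CommRing A] (P : Type*) [AddCommGroup P] [Module A P]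
    (r : ℕ) : Prop :=
  ∀ (𝔭 : Ideal A) (h𝔭 : 𝔭.IsPrime),
    haveI := h𝔭
    Module.Free (Localization.AtPrime 𝔭) (LocalizedModule 𝔭.primeCompl P) ∧
    Module.finrank (Localization.AtPrime 𝔭) (LocalizedModule 𝔭.primeCompl P) = r

/-- Property `Ω(R)` for a projective module `P` over an `R`-algebra `S`. -/
def PropertyOmega (R : Type*) [CommRing R] (S : Type*) [CommRing S] [Algebra R S]
    (P : Type*) [AddCommGroup P] [Module S P] : Prop :=
  ∀ I : Ideal R, ∃ t : R,
    Ideal.Quotient.mk I t ∈ nonZeroDivisors (R ⧸ I) ∧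
    Module.Free
      (Localization (Submonoid.powers
        (Ideal.Quotient.mk (I.map (algebraMap R S)) (algebraMap R S t))))
      (LocalizedModule (Submonoid.powers
        (Ideal.Quotient.mk (I.map (algebraMap R S)) (algebraMap R S t)))
        (P ⧸ ((I.map (algebraMap R S)) • ⊤ : Submodule S P)))


set_option linter.unusedSectionVars false
set_option linter.unusedSimpArgs false
set_option linter.unusedVariables false
set_option linter.unusedDecidableInType false
set_option linter.style.haveILetI false

section RelSec

variable {C : Type*} [CommRing C] {ι : Type*} [Fintype ι] [DecidableEq ι]

inductive RelL (τ : C) : C → (ι → C) → C → (ι → C) → Prop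
  | refl (a : C) (f : ι → C) : RelL τ a f a f
  | s1 {a : C} {f : ι → C} {a' : C} {f' : ι → C} (φ : ι → C) :
      RelL τ (a + τ * (φ ⬝ᵥ f)) f a' f' → RelL τ a f a' f'
  | s2 {a : C} {f : ι → C} {a' : C} {f' : ι → C} (q : ι → C) :
      RelL τ a (f + a • q) a' f' → RelL τ a f a' f'
  | s3 {a : C} {f : ι → C} {a' : C} {f' : ι → C} (M N : Matrix ι ι C)
      (h1 : M + N + τ • (M * N) = 0) (h2 : M + N + τ • (N * M) = 0) :
      RelL τ a (f + τ • M.mulVec f) a' f' → RelL τ a f a' f'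

namespace RelL

variable {τ : C} {a a' a'' : C} {f f' f'' : ι → C}

theorem refl' (h : a = a') (h' : f = f') : RelL τ a f a' f' := by
  subst h h'; exact refl _ _

theorem trans (h : RelL τ a f a' f') (h' : RelL τ a' f' a'' f'') : RelL τ a f a'' f'' := by
  induction h with
  | refl => exact h'
  | s1 φ _ ih => exact s1 φ (ih h')
  | s2 q _ ih => exact s2 q (ih h')
  | s3 M N h1 h2 _ ih => exact s3 M N h1 h2 (ih h')

theorem op1 (φ : ι → C) : RelL τ a f (a + τ * (φ ⬝ᵥ f)) f := s1 φ (refl _ _)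

theorem op2 (q : ι → C) : RelL τ a f a (f + a • q) := s2 q (refl _ _)

theorem symm (h : RelL τ a f a' f') : RelL τ a' f' a f := by
  induction h with
  | refl => exact refl _ _
  | @s1 a f _ _ φ _ ih =>
    refine ih.trans ?_
    have := op1 (τ := τ) (a := a + τ * (φ ⬝ᵥ f)) (f := f) (-φ)
    rwa [neg_dotProduct, mul_neg, add_neg_cancel_right] at this
  | @s2 a f _ _ q _ ih =>
    refine ih.trans ?_
    have := op2 (τ := τ) (a := a) (f := f + a • q) (-q)
    rwa [smul_neg, add_neg_cancel_right] at this
  | @s3 a f _ _ M N h1 h2 _ ih =>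
    refine ih.trans (s3 N M (by rw [← h2]; abel) (by rw [← h1]; abel) ?_)
    have : f + τ • M.mulVec f + τ • N.mulVec (f + τ • M.mulVec f) = f := by
      have h3 : (M + N + τ • (N * M)).mulVec f = 0 := by rw [h2]; simp
      rw [Matrix.add_mulVec, Matrix.add_mulVec, Matrix.smul_mulVec,
        ← Matrix.mulVec_mulVec] at h3
      rw [Matrix.mulVec_add, Matrix.mulVec_smul, add_assoc, ← smul_add, ← add_assoc, h3]
      simp
    rw [this]
    exact refl _ _

theorem map {D : Type*} [CommRing D] (g : C →+* D) (h : RelL τ a f a' f') :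
    RelL (g τ) (g a) (g ∘ f) (g a') (g ∘ f') := by
  induction h with
  | refl => exact refl _ _
  | @s1 a f _ _ φ _ ih =>
    refine s1 (g ∘ φ) ?_
    rwa [← RingHom.map_dotProduct, ← map_mul, ← map_add]
  | @s2 a f _ _ q _ ih =>
    refine s2 (g ∘ q) ?_
    convert ih using 1
    ext i; simp
  | @s3 a f _ _ M N h1 h2 _ ih =>
    refine s3 (M.map g) (N.map g) ?_ ?_ ?_
    · have := congrArg (fun X => X.map g) h1
      simpa [Matrix.map_add, Matrix.map_mul, Matrix.map_smul', Matrix.map_smulₛₗ] using this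
    · have := congrArg (fun X => X.map g) h2
      simpa [Matrix.map_add, Matrix.map_mul, Matrix.map_smul', Matrix.map_smulₛₗ] using this
    · convert ih using 1
      ext i
      simp [RingHom.map_mulVec]

def idl (a : C) (f : ι → C) : Ideal C := Ideal.span {a} ⊔ Ideal.span (Set.range f)

theorem a_mem_idl (a : C) (f : ι → C) : a ∈ idl a f :=
  Ideal.mem_sup_left (Ideal.mem_span_singleton_self a)
theorem f_mem_idl (a : C) (f : ι → C) (i : ι) : f i ∈ idl a f :=
  Ideal.mem_sup_right (Ideal.subset_span ⟨i, rfl⟩)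

theorem idl_le {J : Ideal C} (h : a ∈ J) (h' : ∀ i, f i ∈ J) : idl a f ≤ J := by
  refine sup_le ?_ ?_
  · simpa [Ideal.span_singleton_le_iff_mem] using h
  · rw [Ideal.span_le]; rintro _ ⟨i, rfl⟩; exact h' i

theorem dot_mem {J : Ideal C} (φ : ι → C) (h' : ∀ i, f i ∈ J) : φ ⬝ᵥ f ∈ J :=
  Ideal.sum_mem _ fun i _ => Ideal.mul_mem_left _ _ (h' i)

theorem idl_le' (h : RelL τ a f a' f') : idl a' f' ≤ idl a f := by
  induction h with
  | refl => exact le_rfl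
  | @s1 a f _ _ φ _ ih =>
    refine ih.trans (idl_le ?_ (f_mem_idl _ _))
    exact add_mem (a_mem_idl _ _) (Ideal.mul_mem_left _ _ (dot_mem _ (f_mem_idl _ _)))
  | @s2 a f _ _ q _ ih =>
    refine ih.trans (idl_le (a_mem_idl _ _) fun i => ?_)
    exact add_mem (f_mem_idl _ _ _) (Ideal.mul_mem_right _ _ (a_mem_idl _ _))
  | @s3 a f _ _ M N h1 h2 _ ih =>
    refine ih.trans (idl_le (a_mem_idl _ _) fun i => ?_)
    exact add_mem (f_mem_idl _ _ _) (Ideal.mul_mem_left _ _ (dot_mem _ (f_mem_idl _ _)))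

theorem idl_eq (h : RelL τ a f a' f') : idl a' f' = idl a f := le_antisymm h.idl_le' h.symm.idl_le'

theorem dvd (h : RelL τ a f a' f') (ha : τ ∣ a - 1) : τ ∣ a' - 1 := by
  induction h with
  | refl => exact ha
  | @s1 a f _ _ φ _ ih =>
    refine ih ?_
    rw [add_sub_right_comm]
    exact dvd_add ha (dvd_mul_right _ _)
  | s2 _ _ ih => exact ih ha
  | s3 _ _ _ _ _ ih => exact ih ha

/-- transvections of `f` -/
theorem tv (ha : τ ∣ a - 1) (u v : ι → C) (huv : v ⬝ᵥ u = 0) :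
    RelL τ a f a (f + (v ⬝ᵥ f) • u) := by
  obtain ⟨c, hc⟩ := ha
  set M : Matrix ι ι C := Matrix.vecMulVec u v with hM
  have hMM : M * M = 0 := by
    rw [hM, Matrix.vecMulVec_mul_vecMulVec, huv]; simp
  have hMf : ∀ g : ι → C, M.mulVec g = (v ⬝ᵥ g) • u := by
    intro g; rw [hM, Matrix.vecMulVec_mulVec]; simp
  refine s2 (M.mulVec f) (s3 (-c • M) (c • M) ?_ ?_ ?_)
  · simp [hMM]
  · simp [hMM]
  · have : f + a • M.mulVec f + τ • (-c • M).mulVec (f + a • M.mulVec f) = f + (v ⬝ᵥ f) • u := by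
      rw [Matrix.smul_mulVec, Matrix.mulVec_add, Matrix.mulVec_smul, Matrix.mulVec_mulVec, hMM,
        Matrix.zero_mulVec, smul_zero, add_zero, hMf, add_assoc]
      have ha : a = 1 + τ * c := by rw [← hc]; ring
      rw [ha, add_smul, one_smul]
      ext i
      simp
      ring
    rw [this]
    exact refl _ _

/-- adding to `f i` an element of the ideal of the rest. -/
theorem add_single (ha : τ ∣ a - 1) (i : ι) (z : C)
    (hz : z ∈ Ideal.span {a} ⊔ Ideal.span (f '' {i}ᶜ)) :
    RelL τ a f a (Function.update f i (f i + z)) := by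
  obtain ⟨y, hy, w, hw, rfl⟩ := Submodule.mem_sup.1 hz
  obtain ⟨x0, rfl⟩ := Ideal.mem_span_singleton'.1 hy
  have hw' : ∃ x : ι → C, x i = 0 ∧ w = x ⬝ᵥ f := by
    clear hz hy
    induction hw using Submodule.span_induction with
    | mem w h =>
      obtain ⟨k, hk, rfl⟩ := h
      exact ⟨Pi.single k 1, by simp [Pi.single_apply, Ne.symm hk], by simp⟩
    | zero => exact ⟨0, rfl, by simp⟩
    | add x y _ _ hx hy =>
      obtain ⟨x1, h1, rfl⟩ := hx
      obtain ⟨x2, h2, rfl⟩ := hy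
      exact ⟨x1 + x2, by simp [h1, h2], by rw [add_dotProduct]⟩
    | smul c x _ hx =>
      obtain ⟨x1, h1, rfl⟩ := hx
      exact ⟨c • x1, by simp [h1], by rw [smul_dotProduct]⟩
  obtain ⟨x, hx, rfl⟩ := hw'
  have h1 : RelL τ a f a (f + (x ⬝ᵥ f) • Pi.single i 1) := tv ha _ _ (by simp [hx])
  refine h1.trans ?_
  refine s2 (Pi.single i x0) ?_
  refine refl' rfl ?_
  ext k
  by_cases hk : k = i
  · subst hk; simp; ring
  · simp [hk]

theorem finish (ha : τ ∣ a - 1) (h : (1 : C) ∈ Ideal.span (Set.range f)) : RelL τ a f 1 0 := by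
  obtain ⟨c, hc⟩ := ha
  rw [Ideal.mem_span_range_iff_exists_fun] at h
  obtain ⟨φ, hφ⟩ := h
  refine s1 (-c • φ) ?_
  have : a + τ * ((-c • φ) ⬝ᵥ f) = 1 := by
    rw [smul_dotProduct, show φ ⬝ᵥ f = 1 from hφ]
    have ha : a = 1 + τ * c := by rw [← hc]; ring
    rw [ha]; simp
  rw [this]
  refine s2 (-f) ?_
  refine refl' rfl ?_
  simp

end RelL
end RelSec


section TwoSec

variable {C : Type*} [CommRing C] {ι : Type*} [Fintype ι] [DecidableEq ι]

theorem RelL.two {τ a : C} {f : ι → C} {i j : ι} (hij : i ≠ j) (k11 k12 k21 k22 : C)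
    (h : k11 + k22 + τ * (k11 * k22 - k12 * k21) = 0) :
    RelL τ a f a (Function.update (Function.update f j (f j + τ * (k11 * f j + k12 * f i))) i
      (f i + τ * (k21 * f j + k22 * f i))) := by
  refine RelL.s3
    (Matrix.single j j k11 + Matrix.single j i k12 + Matrix.single i j k21 + Matrix.single i i k22)
    (Matrix.single j j k22 + Matrix.single j i (-k12) + Matrix.single i j (-k21)
      + Matrix.single i i k11) ?_ ?_ (RelL.refl' rfl ?_)
  · have hji := hij.symm
    simp only [add_mul, mul_add, Matrix.single_mul_single_same, 
      Matrix.single_mul_single_of_ne _ _ _ _ hij, Matrix.single_mul_single_of_ne _ _ _ _ hji]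
    ext p q
    simp only [Matrix.add_apply, Matrix.smul_apply, Matrix.single_apply, Matrix.zero_apply, smul_eq_mul]
    rcases eq_or_ne p j with rfl | hp
    · rcases eq_or_ne q p with rfl | hq
      · simp [hij, hji]; linear_combination h
      · rcases eq_or_ne q i with rfl | hq'
        · simp [hij, hji]; try ring
        · simp [hij, hji, hq.symm, hq'.symm]
    · rcases eq_or_ne p i with rfl | hp'
      · rcases eq_or_ne q p with rfl | hq
        · simp [hij, hji]; linear_combination h
        · rcases eq_or_ne q j with rfl | hq'
          · simp [hij, hji]; try ring
          · simp [hij, hji, hq.symm, hq'.symm]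
      · simp [hp.symm, hp'.symm]
  · have hji := hij.symm
    simp only [add_mul, mul_add, Matrix.single_mul_single_same, 
      Matrix.single_mul_single_of_ne _ _ _ _ hij, Matrix.single_mul_single_of_ne _ _ _ _ hji]
    ext p q
    simp only [Matrix.add_apply, Matrix.smul_apply, Matrix.single_apply, Matrix.zero_apply, smul_eq_mul]
    rcases eq_or_ne p j with rfl | hp
    · rcases eq_or_ne q p with rfl | hq
      · simp [hij, hji]; linear_combination h
      · rcases eq_or_ne q i with rfl | hq'
        · simp [hij, hji]; try ring
        · simp [hij, hji, hq.symm, hq'.symm]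
    · rcases eq_or_ne p i with rfl | hp'
      · rcases eq_or_ne q p with rfl | hq
        · simp [hij, hji]; linear_combination h
        · rcases eq_or_ne q j with rfl | hq'
          · simp [hij, hji]; try ring
          · simp [hij, hji, hq.symm, hq'.symm]
      · simp [hp.symm, hp'.symm]
  · ext p
    simp only [Matrix.add_mulVec, Matrix.single_mulVec, Pi.add_apply, Pi.smul_apply, smul_eq_mul,
      Function.update_apply, Pi.single_apply, Function.update_apply]
    by_cases hp : p = i
    · subst hp; simp [hij]
    · by_cases hp' : p = j
      · subst hp'; simp [hp]
      · simp [hp, hp']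

end TwoSec

section Delta
variable {Q : Type*} [CommRing Q]

/-- `p (x + Z)` as a polynomial in `Z`. -/
noncomputable def tayl (x : Q[X]) : Q[X] →+* Q[X][X] :=
  Polynomial.eval₂RingHom ((Polynomial.C).comp Polynomial.C) (Polynomial.C x + Polynomial.X)

noncomputable def dlt (x z p : Q[X]) : Q[X] := (Polynomial.divX (tayl x p)).eval z

theorem tayl_eval (x z p : Q[X]) : (tayl x p).eval z = p.comp (x + z) := by
  have : ((Polynomial.evalRingHom z).comp (tayl x)) = Polynomial.compRingHom (x + z) := by
    ext <;> simp [tayl]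
  exact congrArg (fun h => h p) this

theorem tayl_coeff (x p : Q[X]) : (tayl x p).coeff 0 = p.comp x := by
  rw [Polynomial.coeff_zero_eq_eval_zero, tayl_eval, add_zero]

theorem tayl_decomp (x p : Q[X]) : tayl x p = Polynomial.X * Polynomial.divX (tayl x p) +
    Polynomial.C (p.comp x) := by
  conv_lhs => rw [← Polynomial.X_mul_divX_add (tayl x p)]
  rw [tayl_coeff]

theorem comp_dlt (x z p : Q[X]) : p.comp (x + z) = p.comp x + z * dlt x z p := by
  rw [← tayl_eval, tayl_decomp]
  simp [dlt]; ring

theorem dlt_rel (x z : Q[X]) {α f β g : Q[X]} {s : Q} (h : α * f + β * g = Polynomial.C s) :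
    α.comp x * dlt x z f + dlt x z α * f.comp x + β.comp x * dlt x z g + dlt x z β * g.comp x
      + z * (dlt x z α * dlt x z f + dlt x z β * dlt x z g) = 0 := by
  have h1 := congrArg (tayl x) h
  have h2 := congrArg (Polynomial.compRingHom x) h
  rw [map_add, map_mul, map_mul, tayl_decomp x α, tayl_decomp x f, tayl_decomp x β,
    tayl_decomp x g] at h1
  simp only [map_add, map_mul, Polynomial.coe_compRingHom_apply, Polynomial.C_comp] at h2
  have h3 := congrArg (Polynomial.C : Q[X] →+* Q[X][X]) h2
  simp only [map_add, map_mul] at h3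
  have h4 : tayl x (Polynomial.C s) = Polynomial.C (Polynomial.C s) := by simp [tayl]
  rw [h4] at h1
  have h5 : (Polynomial.X : Q[X][X]) * (Polynomial.C (α.comp x) * divX (tayl x f)
     + divX (tayl x α) * Polynomial.C (f.comp x) + Polynomial.C (β.comp x) * divX (tayl x g)
     + divX (tayl x β) * Polynomial.C (g.comp x)
     + Polynomial.X * (divX (tayl x α) * divX (tayl x f) + divX (tayl x β) * divX (tayl x g))) = 0 := by
    linear_combination h1 - h3
  have h6 := (Polynomial.isRegular_X (R := Q[X])).left.eq_iff.1 (h5.trans (mul_zero _).symm)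
  have h7 := congrArg (Polynomial.eval z) h6
  simpa [dlt] using h7

theorem dlt_affine (x z p : Q[X]) (s t : Q) : dlt x z (Polynomial.C s + Polynomial.C t * p) =
    Polynomial.C t * dlt x z p := by
  have : divX (tayl x (Polynomial.C s + Polynomial.C t * p)) =
      Polynomial.C (Polynomial.C t) * divX (tayl x p) := by
    have h4 : ∀ s, tayl x (Polynomial.C s) = Polynomial.C (Polynomial.C s) := by simp [tayl]
    rw [map_add, map_mul, h4, h4]
    ext n : 1
    simp [Polynomial.coeff_divX, Polynomial.coeff_C]
  rw [dlt, this]; simp [dlt]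

end Delta

section Suslin
variable {Q : Type*} [CommRing Q] {ι : Type*} [Fintype ι] [DecidableEq ι]

def susIdeal (τ : Q) (a : Q[X]) (f : ι → Q[X]) : Ideal Q where
  carrier := {s | ∀ x y : Q[X], RelL (Polynomial.C τ) (a.comp x) (fun i => (f i).comp x)
    (a.comp (x + Polynomial.C s * y)) (fun i => (f i).comp (x + Polynomial.C s * y))}
  zero_mem' := by intro x y; simpa using RelL.refl _ _
  add_mem' := by
    intro s t hs ht x y
    have := (hs x y).trans (ht _ y)
    rw [map_add, add_mul, ← add_assoc]
    exact this
  smul_mem' := by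
    intro c s hs x y
    have := hs x (Polynomial.C c * y)
    rw [← mul_assoc, ← map_mul, mul_comm s c] at this
    exact this

theorem susIdeal_congr {τ : Q} {a a' : Q[X]} {f f' : ι → Q[X]}
    (h : RelL (Polynomial.C τ) a f a' f') : susIdeal τ a' f' ≤ susIdeal τ a f := by
  intro s hs x y
  have h1 : ∀ x, RelL (Polynomial.C τ) (a.comp x) (fun i => (f i).comp x)
      (a'.comp x) (fun i => (f' i).comp x) := by
    intro x
    have := h.map (Polynomial.compRingHom x)
    simpa [Function.comp_def] using this
  exact ((h1 _).trans (hs x y)).trans (h1 _).symm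

theorem sus_step {τ : Q} (hτ : τ ∈ nonZeroDivisors Q) {a : Q[X]} {f : ι → Q[X]} {i j : ι}
    (hij : i ≠ j) {c ft gt αt βt : Q[X]} {s : Q} (ha : a = 1 + Polynomial.C τ * c)
    (hf : f j = 1 + Polynomial.C τ * ft) (hg : f i = Polynomial.C τ * gt)
    (hs : (Polynomial.C s + Polynomial.C τ * αt) * f j + (Polynomial.C τ * βt) * f i
      = Polynomial.C s) : s ∈ susIdeal τ a f := by
  intro x y
  set z := Polynomial.C s * y with hz
  set α := Polynomial.C s + Polynomial.C τ * αt with hα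
  set β := Polynomial.C τ * βt with hβ
  have hτ' : (Polynomial.C τ : Q[X]) ∈ nonZeroDivisors Q[X] := by
    rw [mem_nonZeroDivisors_iff_right] at *
    intro p hp
    ext n
    have := congrArg (fun q => q.coeff n) hp
    simp at this
    simpa using hτ _ this
  have hsx : α.comp x * (f j).comp x + β.comp x * (f i).comp x = Polynomial.C s := by
    have h2 := congrArg (Polynomial.compRingHom x) hs
    simpa using h2
  have hdF : dlt x z (f j) = Polynomial.C τ * dlt x z ft := by
    rw [hf, ← dlt_affine x z ft 1 τ, Polynomial.C_1]
  have hdG : dlt x z (f i) = Polynomial.C τ * dlt x z gt := by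
    rw [hg, ← dlt_affine x z gt 0 τ, Polynomial.C_0, zero_add]
  have hdA : dlt x z α = Polynomial.C τ * dlt x z αt := by
    rw [hα, ← dlt_affine x z αt s τ]
  have hdB : dlt x z β = Polynomial.C τ * dlt x z βt := by
    rw [hβ, ← dlt_affine x z βt 0 τ, Polynomial.C_0, zero_add]
  have hda : dlt x z a = Polynomial.C τ * dlt x z c := by
    rw [ha, ← dlt_affine x z c 1 τ, Polynomial.C_1]
  have hrel := dlt_rel x z hs
  -- the vector `v` with `v ⬝ f = s`
  set v : ι → Q[X] := Pi.single j (α.comp x) + Pi.single i (β.comp x) with hv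
  have hvf : ∀ f' : ι → Q[X], f' j = (f j).comp x → f' i = (f i).comp x →
      v ⬝ᵥ f' = Polynomial.C s := by
    intro f' h1 h2
    rw [hv, add_dotProduct, single_dotProduct, single_dotProduct, h1, h2, hsx]
  have hax : Polynomial.C τ ∣ a.comp x - 1 := ⟨c.comp x, by rw [ha]; simp⟩
  set f1 : ι → Q[X] := fun l => if l = i ∨ l = j then (f l).comp x else (f l).comp (x + z) with hf1
  have hf1i : f1 i = (f i).comp x := by simp [hf1]
  have hf1j : f1 j = (f j).comp x := by simp [hf1]
  have R1 : RelL (Polynomial.C τ) (a.comp x) (fun i => (f i).comp x) (a.comp x) f1 := by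
    have := RelL.tv (f := fun i => (f i).comp x) hax
      (fun l => if l = i ∨ l = j then 0 else y * dlt x z (f l)) v
      (by rw [hv, add_dotProduct, single_dotProduct, single_dotProduct]; simp)
    refine this.trans (RelL.refl' rfl ?_)
    rw [hvf _ rfl rfl]
    ext1 l
    by_cases hl : l = i ∨ l = j
    · simp [hl, hf1]
    · simp only [hl, hf1, Pi.add_apply, Pi.smul_apply, if_false, smul_eq_mul]
      rw [comp_dlt x z (f l), hz]; ring
  have R2 : RelL (Polynomial.C τ) (a.comp x) f1 (a.comp (x + z)) f1 := by
    refine (RelL.op1 ((y * dlt x z c) • v)).trans (RelL.refl' ?_ rfl)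
    rw [smul_dotProduct, hvf _ hf1j hf1i, comp_dlt x z a, hda, hz, smul_eq_mul]; ring
  refine R1.trans (R2.trans ?_)
  have R3 := RelL.two (τ := Polynomial.C τ) (a := a.comp (x + z)) (f := f1) hij
    (y * (dlt x z ft * α.comp x + dlt x z βt * (f i).comp x))
    (y * (dlt x z ft * β.comp x - dlt x z βt * (f j).comp x))
    (y * (dlt x z gt * α.comp x - dlt x z αt * (f i).comp x))
    (y * (dlt x z gt * β.comp x + dlt x z αt * (f j).comp x)) ?_
  · refine R3.trans (RelL.refl' rfl ?_)
    ext1 l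
    rw [Function.update_apply, Function.update_apply]
    by_cases hl : l = i
    · subst hl
      rw [if_pos rfl, hf1i, hf1j, comp_dlt x z (f l), hdG]
      linear_combination (Polynomial.C τ) * y * (dlt x z gt) * hsx
    · rw [if_neg hl]
      by_cases hl' : l = j
      · subst hl'
        rw [if_pos rfl, hf1i, hf1j, comp_dlt x z (f l), hdF]
        linear_combination (Polynomial.C τ) * y * (dlt x z ft) * hsx
      · rw [if_neg hl']
        simp [hf1, hl, hl']
  · rw [hdF, hdG, hdA, hdB] at hrel
    refine (mem_nonZeroDivisors_iff_right.1 hτ') _ ?_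
    linear_combination y * hrel + y ^ 2 * (Polynomial.C τ) ^ 2 * 
      (dlt x z ft * dlt x z αt + dlt x z βt * dlt x z gt) * hsx

end Suslin


theorem exists_coprime_shift {k : Type*} [Field k] {u f y v g : k[X]}
    (h : u * f + y + v * g = 1) (hg : g ≠ 0) : ∃ w, IsCoprime (f + w * y) g := by
  classical
  set s := (UniqueFactorizationMonoid.normalizedFactors g).filter (fun p => ¬ p ∣ f) with hs
  refine ⟨s.prod, isCoprime_of_prime_dvd (fun h => hg h.2) ?_⟩
  intro p hp h1 h2
  obtain ⟨q, hq, hpq⟩ := UniqueFactorizationMonoid.exists_mem_normalizedFactors_of_dvd hg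
    hp.irreducible h2
  by_cases hpf : p ∣ f
  · have h3 : p ∣ s.prod * y := (dvd_add_right hpf).1 h1
    rcases hp.dvd_or_dvd h3 with h4 | h4
    · obtain ⟨q', hq', hpq'⟩ := hp.exists_mem_multiset_dvd h4
      rw [hs, Multiset.mem_filter] at hq'
      have hirr := UniqueFactorizationMonoid.irreducible_of_normalized_factor q' hq'.1
      have : Associated p q' := (hp.irreducible.dvd_irreducible_iff_associated hirr).1 hpq'
      exact hq'.2 (this.symm.dvd.trans hpf)
    · apply hp.not_isUnit
      rw [isUnit_iff_dvd_one, ← h]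
      exact dvd_add (dvd_add (hpf.mul_left _) h4) (h2.mul_left _)
  · have hq' : q ∈ s := by
      rw [hs, Multiset.mem_filter]
      exact ⟨hq, fun h => hpf (hpq.dvd.trans h)⟩
    have h3 : p ∣ s.prod * y := (hpq.dvd.trans (Multiset.dvd_prod hq')).mul_right _
    exact hpf ((dvd_add_left h3).1 h1)

section
variable {Q : Type*} [CommRing Q] {ι : Type*} [Fintype ι] [DecidableEq ι]

theorem exists_const_mem {m : Ideal Q} [hm : m.IsPrime] {F g : Q[X]} (hg : g.Monic)
    (h : IsCoprime (F.map (Ideal.Quotient.mk m)) (g.map (Ideal.Quotient.mk m))) :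
    ∃ s, s ∉ m ∧ Polynomial.C s ∈ Ideal.span {F, g} := by
  by_contra hcon
  push Not at hcon
  have hintg : Algebra.IsIntegral Q (AdjoinRoot g) := by
    have := hg.finite_adjoinRoot
    infer_instance
  set J : Ideal Q[X] := Ideal.span {F, g} with hJ
  have hle : (J.map (AdjoinRoot.mk g)).comap (algebraMap Q (AdjoinRoot g)) ≤ m := by
    intro s hs
    by_contra hsm
    refine hcon s hsm ?_
    rw [Ideal.mem_comap, AdjoinRoot.algebraMap_eq, ← AdjoinRoot.mk_C,
      Ideal.mem_map_iff_of_surjective _ AdjoinRoot.mk_surjective] at hs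
    obtain ⟨x, hx, hxs⟩ := hs
    rw [AdjoinRoot.mk_eq_mk] at hxs
    have h1 : g ∈ J := Ideal.subset_span (by simp)
    have h2 := J.mem_of_dvd hxs h1
    have := J.sub_mem hx h2
    simpa using this
  obtain ⟨𝔓, h𝔓, h1, h2⟩ := Ideal.exists_ideal_over_prime_of_isIntegral m _ hle
  apply h1.ne_top
  rw [Ideal.eq_top_iff_one]
  obtain ⟨a, b, hab⟩ := h
  obtain ⟨a, rfl⟩ := Polynomial.map_surjective _ Ideal.Quotient.mk_surjective a
  obtain ⟨b, rfl⟩ := Polynomial.map_surjective _ Ideal.Quotient.mk_surjective b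
  have h3 : ((a * F + b * g - 1).map (Ideal.Quotient.mk m)) = 0 := by
    simp [hab]
  have h4 : a * F + b * g - 1 ∈ m.map (Polynomial.C : Q →+* Q[X]) := by
    rw [Ideal.mem_map_C_iff]
    intro n
    rw [← Ideal.Quotient.eq_zero_iff_mem, ← Polynomial.coeff_map, h3, Polynomial.coeff_zero]
  have h5 : m.map (Polynomial.C : Q →+* Q[X]) ≤ 𝔓.comap (AdjoinRoot.mk g) := by
    rw [Ideal.map_le_iff_le_comap]
    intro x hx
    rw [← h2] at hx
    rw [Ideal.mem_comap, Ideal.mem_comap, AdjoinRoot.mk_C]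
    exact hx
  have h6 : J ≤ 𝔓.comap (AdjoinRoot.mk g) := by
    rw [← Ideal.map_le_iff_le_comap]; exact h𝔓
  have h7 : a * F + b * g ∈ J := add_mem (Ideal.mul_mem_left _ _ (Ideal.subset_span (by simp)))
    (Ideal.mul_mem_left _ _ (Ideal.subset_span (by simp)))
  have := (𝔓.comap (AdjoinRoot.mk g)).sub_mem (h6 h7) (h5 h4)
  simpa using this

/-- splitting off two coordinates -/
theorem idl_split2 {C : Type*} [CommRing C] {a : C} {f : ι → C} (h : RelL.idl a f = ⊤) (i j : ι) :
    ∃ u v y, y ∈ Ideal.span {a} ⊔ Ideal.span (f '' {i, j}ᶜ) ∧ u * f j + y + v * f i = 1 := by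
  have h1 : (1 : C) ∈ RelL.idl a f := by rw [h]; trivial
  have h2 : RelL.idl a f ≤ (Ideal.span {a} ⊔ Ideal.span (f '' {i, j}ᶜ)) ⊔
      (Ideal.span {f j} ⊔ Ideal.span {f i}) := by
    refine RelL.idl_le ?_ ?_
    · exact Ideal.mem_sup_left (Ideal.mem_sup_left (Ideal.mem_span_singleton_self _))
    · intro l
      by_cases hl : l = i
      · subst hl
        exact Ideal.mem_sup_right (Ideal.mem_sup_right (Ideal.mem_span_singleton_self _))
      by_cases hl' : l = j
      · subst hl'
        exact Ideal.mem_sup_right (Ideal.mem_sup_left (Ideal.mem_span_singleton_self _))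
      · exact Ideal.mem_sup_left (Ideal.mem_sup_right (Ideal.subset_span
          ⟨l, by simp [hl, hl'], rfl⟩))
  obtain ⟨y, hy, z, hz, hyz⟩ := Submodule.mem_sup.1 (h2 h1)
  obtain ⟨z1, h1, z2, h2, rfl⟩ := Submodule.mem_sup.1 hz
  obtain ⟨u, rfl⟩ := Ideal.mem_span_singleton'.1 h1
  obtain ⟨v, rfl⟩ := Ideal.mem_span_singleton'.1 h2
  exact ⟨u, v, y, hy, by rw [← hyz]; ring⟩

theorem susIdeal_not_le {τ : Q} (hτ : τ ∈ nonZeroDivisors Q) {a : Q[X]} {f : ι → Q[X]} {i j : ι}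
    (hij : i ≠ j) (ha : Polynomial.C τ ∣ a - 1) (hu : RelL.idl a f = ⊤) (hg : (f i).Monic)
    (hfj : Polynomial.C τ ∣ f j - 1)
    (m : Ideal Q) [hm : m.IsMaximal] : ¬ susIdeal τ a f ≤ m := by
  obtain ⟨u, v, y, hy, huv⟩ := idl_split2 hu i j
  letI := Ideal.Quotient.field m
  set π := Ideal.Quotient.mk m with hπ
  have hex : ∃ h : Q[X], IsCoprime ((f j + Polynomial.C τ * h * y).map π) ((f i).map π) := by
    by_cases hτm : τ ∈ m
    · refine ⟨0, ?_⟩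
      obtain ⟨c, hc⟩ := hfj
      have : (f j).map π = 1 := by
        rw [sub_eq_iff_eq_add.1 hc]
        have : π τ = 0 := Ideal.Quotient.eq_zero_iff_mem.2 hτm
        simp [this]
      rw [mul_zero, zero_mul, add_zero, this]
      exact isCoprime_one_left
    · have h1 := congrArg (Polynomial.map π) huv
      simp only [Polynomial.map_add, Polynomial.map_mul, Polynomial.map_one] at h1
      obtain ⟨w, hw⟩ := exists_coprime_shift h1 (hg.map π).ne_zero
      have hτ0 : π τ ≠ 0 := fun h => hτm (Ideal.Quotient.eq_zero_iff_mem.1 h)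
      obtain ⟨h, hh⟩ := Polynomial.map_surjective π Ideal.Quotient.mk_surjective
        (Polynomial.C (π τ)⁻¹ * w)
      refine ⟨h, ?_⟩
      convert hw using 2
      rw [Polynomial.map_add, Polynomial.map_mul, Polynomial.map_mul, hh, Polynomial.map_C,
        ← mul_assoc, ← Polynomial.C_mul, mul_inv_cancel₀ hτ0, Polynomial.C_1, one_mul]
  obtain ⟨h, hh⟩ := hex
  set F := f j + Polynomial.C τ * h * y with hF
  obtain ⟨s, hsm, hs⟩ := exists_const_mem hg hh
  obtain ⟨α0, β0, hs⟩ := Ideal.mem_span_pair.1 hs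
  have hsub : Ideal.span {a} ⊔ Ideal.span (f '' {i, j}ᶜ) ≤
      Ideal.span {a} ⊔ Ideal.span (f '' {j}ᶜ) := by
    refine sup_le_sup le_rfl (Ideal.span_mono (Set.image_mono ?_))
    intro x hx; simp at hx ⊢; exact hx.2
  have R1 : RelL (Polynomial.C τ) a f a (Function.update f j F) :=
    RelL.add_single ha j _ (Ideal.mul_mem_left _ _ (hsub hy))
  set f1 := Function.update f j F with hf1
  have hf1j : f1 j = F := by simp [hf1]
  have hf1i : f1 i = f i := by simp [hf1, hij]
  have R2 : RelL (Polynomial.C τ) a f1 a (Function.update f1 i (f1 i + (- f i * f1 j))) :=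
    RelL.add_single ha i _ (Ideal.mul_mem_left _ _ (Ideal.mem_sup_right
      (Ideal.subset_span ⟨j, by simp [hij.symm], rfl⟩)))
  have R := R1.trans R2
  set f2 := Function.update f1 i (f1 i + (- f i * f1 j)) with hf2
  have hf2j : f2 j = F := by simp [hf2, hij.symm, hf1j]
  have hf2i : f2 i = f i - f i * F := by simp [hf2, hf1j, hf1i]; ring
  intro hle
  apply hsm
  apply hle
  apply susIdeal_congr R
  obtain ⟨c, hc⟩ := ha
  obtain ⟨ft0, hft0⟩ := hfj
  have hF' : F = 1 + Polynomial.C τ * (ft0 + h * y) := by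
    rw [hF, sub_eq_iff_eq_add.1 hft0]; ring
  set ft := ft0 + h * y with hft
  set α := α0 + β0 * f i + β0 * f2 i with hα
  refine sus_step (c := c) (ft := ft) (gt := - f i * ft) (βt := -β0 * ft) 
    (αt := -(-β0 * ft * f2 i + α * ft)) hτ hij ?_ ?_ ?_ ?_
  · rw [← hc]; ring
  · rw [hf2j, hF']
  · rw [hf2i, hF']; ring
  · have e1 : (Polynomial.C s : Q[X]) = (α0 + β0 * f i) * F + β0 * f2 i := by
      rw [hf2i, ← hs]; ring
    have e2 : (Polynomial.C s : Q[X]) = α * F + (Polynomial.C τ * (-β0 * ft)) * f2 i := by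
      rw [e1, hα]; rw [hF']; ring
    have e3 : Polynomial.C s + Polynomial.C τ * (-(-β0 * ft * f2 i + α * ft)) = α := by
      rw [e2]; linear_combination α * hF'
    rw [e3, hf2j]; exact e2.symm

theorem suslin_poly {τ : Q} (hτ : τ ∈ nonZeroDivisors Q) {a : Q[X]} {f : ι → Q[X]} {i j : ι}
    (hij : i ≠ j) (ha : Polynomial.C τ ∣ a - 1) (hu : RelL.idl a f = ⊤) (hg : (f i).Monic)
    (hg0 : (f i).coeff 0 = 1) : RelL (Polynomial.C τ) a f 1 0 := by
  have R1 : RelL (Polynomial.C τ) a f a (Function.update f j (f j + (1 - f j) * a)) :=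
    RelL.add_single ha j _ (Ideal.mul_mem_left _ _ (Ideal.mem_sup_left
      (Ideal.mem_span_singleton_self _)))
  refine R1.trans ?_
  have hu' := R1.idl_eq
  set f1 := Function.update f j (f j + (1 - f j) * a) with hf1
  have hf1j : f1 j = (f j + (1 - f j) * a) := by simp [hf1]
  have hf1i : f1 i = f i := by simp [hf1, hij]
  have htop : susIdeal τ a f1 = ⊤ := by
    by_contra hne
    obtain ⟨m, hm, hle⟩ := Ideal.exists_le_maximal _ hne
    refine susIdeal_not_le hτ hij ha (hu'.trans hu) (hf1i ▸ hg) ?_ m hle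
    rw [hf1j]
    have : f j + (1 - f j) * a - 1 = (1 - f j) * (a - 1) := by ring
    rw [this]; exact ha.mul_left _
  have h1 : (1 : Q) ∈ susIdeal τ a f1 := by rw [htop]; trivial
  have R2 := h1 Polynomial.X (- Polynomial.X)
  simp only [Polynomial.comp_X, Polynomial.C_1, one_mul, add_neg_cancel] at R2
  refine R2.trans (RelL.finish (R2.dvd ha) ?_)
  apply Ideal.subset_span
  refine ⟨i, ?_⟩
  show (f1 i).comp 0 = 1
  rw [hf1i, Polynomial.comp_zero, ← Polynomial.coeff_zero_eq_eval_zero, hg0, Polynomial.C_1]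

end


section
open LaurentPolynomial
variable {Q : Type*} [CommRing Q] {ι : Type*} [Fintype ι] [DecidableEq ι]

theorem laurent_red {g : Q[X]} (hg : g.coeff 0 = 1) (b : Q[T;T⁻¹]) :
    ∃ p : Q[X], ∃ q : Q[T;T⁻¹], toLaurent p = b + toLaurent g * q := by
  obtain ⟨n, p', hp'⟩ := b.exists_T_pow
  have hT : (T (-1) : Q[T;T⁻¹]) - toLaurent (-(divX g)) = T (-1) * toLaurent g := by
    conv_rhs => rw [← X_mul_divX_add g]
    rw [hg, map_add, map_mul, toLaurent_X, mul_add, ← mul_assoc, ← T_add]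
    simp [add_comm]
  have hb : b = toLaurent p' * (T (-1)) ^ n := by
    rw [hp', T_pow, mul_assoc, ← T_add]; simp
  obtain ⟨w, hw⟩ := sub_dvd_pow_sub_pow (T (-1) : Q[T;T⁻¹]) (toLaurent (-(divX g))) n
  refine ⟨p' * (-(divX g)) ^ n, - (toLaurent p' * T (-1) * w), ?_⟩
  rw [hT] at hw
  rw [map_mul, map_pow, hb]
  linear_combination (- toLaurent p') * hw

theorem poly_uni_of_laurent {a : Q[X]} {f : ι → Q[X]} {i : ι}
    (h : RelL.idl (toLaurent a) (toLaurent ∘ f) = ⊤) (hi : (f i).coeff 0 = 1) :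
    RelL.idl a f = ⊤ := by
  by_contra hne
  obtain ⟨m, hm, hle⟩ := Ideal.exists_le_maximal _ hne
  have hX : (X : Q[X]) ∉ m := by
    intro hX
    apply hm.ne_top
    rw [Ideal.eq_top_iff_one]
    have h1 : f i ∈ m := hle (RelL.f_mem_idl _ _ _)
    have h2 : X * divX (f i) ∈ m := Ideal.mul_mem_right _ _ hX
    have := m.sub_mem h1 h2
    have e : f i - X * divX (f i) = 1 := by
      have := X_mul_divX_add (f i)
      rw [hi] at this
      rw [sub_eq_iff_eq_add]
      refine this.symm.trans ?_
      simp [add_comm]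
    rwa [e] at this
  have hdis : Disjoint (Submonoid.powers (X : Q[X]) : Set Q[X]) (m : Set Q[X]) := by
    rw [Set.disjoint_left]
    rintro _ ⟨n, rfl⟩ hn
    exact hX (hm.isPrime.mem_of_pow_mem n hn)
  have hp := IsLocalization.isPrime_of_isPrime_disjoint (Submonoid.powers (X : Q[X])) Q[T;T⁻¹] m
    hm.isPrime hdis
  apply hp.ne_top
  rw [eq_top_iff, ← h]
  refine RelL.idl_le ?_ ?_
  · exact Ideal.mem_map_of_mem _ (hle (RelL.a_mem_idl _ _))
  · intro l
    exact Ideal.mem_map_of_mem _ (hle (RelL.f_mem_idl _ _ _))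

theorem laurent_core_monic {τ : Q} (hτ : τ ∈ nonZeroDivisors Q) {a : Q[T;T⁻¹]}
    {f : ι → Q[T;T⁻¹]} {i d : ι}
    (hid : i ≠ d) (ha : LaurentPolynomial.C τ ∣ a - 1) (hu : RelL.idl a f = ⊤) {g : Q[X]} {N : ℤ}
    (hg : g.Monic) (hg0 : g.coeff 0 = 1) (hfd : f d = T N * toLaurent g) :
    RelL (LaurentPolynomial.C τ) a f 1 0 := by
  have hG : toLaurent g = T (-N) * f d := by
    rw [hfd, ← mul_assoc, ← T_add]; simp
  obtain ⟨ρ, q, hρ⟩ := laurent_red hg0 (f i)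
  set n := ρ.natDegree + 1 with hn
  set h : Q[X] := ρ + g * (Polynomial.C (1 - ρ.coeff 0) + X ^ n) with hh
  have hh0 : h.coeff 0 = 1 := by
    rw [hh, coeff_add, mul_coeff_zero, hg0, coeff_add]
    simp [hn]
  have hhm : h.Monic := by
    nontriviality Q
    have e : h = g * X ^ n + (ρ + g * Polynomial.C (1 - ρ.coeff 0)) := by rw [hh]; ring
    rw [e]
    refine Monic.add_of_left (hg.mul (monic_X_pow n)) ?_
    rw [(monic_X_pow n).degree_mul, degree_X_pow]
    have hgd : (0 : WithBot ℕ) ≤ g.degree := by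
      rw [zero_le_degree_iff]; exact hg.ne_zero
    have h1 : ρ.degree < n := by
      refine lt_of_le_of_lt degree_le_natDegree ?_
      exact_mod_cast Nat.lt_succ_self _
    refine lt_of_le_of_lt (degree_add_le _ _) (max_lt ?_ ?_)
    · refine lt_of_lt_of_le h1 ?_
      exact le_add_of_nonneg_left hgd
    · refine lt_of_le_of_lt (degree_mul_le _ _) ?_
      refine lt_of_le_of_lt (add_le_add le_rfl degree_C_le) ?_
      rw [degree_eq_natDegree hg.ne_zero]
      exact_mod_cast (by omega)
  have R1 : RelL (LaurentPolynomial.C τ) a f a (Function.update f i (f i +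
      (T (-N) * (q + toLaurent (Polynomial.C (1 - ρ.coeff 0) + X ^ n))) * f d)) :=
    RelL.add_single ha i _ (Ideal.mul_mem_left _ _ (Ideal.mem_sup_right
      (Ideal.subset_span ⟨d, by simp [hid.symm], rfl⟩)))
  refine R1.trans ?_
  set f1 := Function.update f i (f i +
      (T (-N) * (q + toLaurent (Polynomial.C (1 - ρ.coeff 0) + X ^ n))) * f d) with hf1
  have hf1i : f1 i = toLaurent h := by
    simp only [hf1, Function.update_self]
    rw [hh, map_add toLaurent ρ, map_mul, hρ, hG]
    ring
  choose p qq hp using fun l => laurent_red hh0 (f1 l)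
  have R2 : RelL (LaurentPolynomial.C τ) a f1 a
      (f1 + ((Pi.single i 1 : ι → Q[T;T⁻¹]) ⬝ᵥ f1) • (fun l => if l = i then 0 else qq l)) :=
    RelL.tv ha _ _ (by simp)
  set p' : ι → Q[X] := fun l => if l = i then h else p l with hp'
  have e2 : (f1 + ((Pi.single i 1 : ι → Q[T;T⁻¹]) ⬝ᵥ f1) • (fun l => if l = i then 0 else qq l))
      = toLaurent ∘ p' := by
    ext1 l
    simp only [single_dotProduct, one_mul, hf1i, Pi.add_apply, Pi.smul_apply, smul_eq_mul,
      Function.comp_apply, hp']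
    by_cases hl : l = i
    · subst hl; simp [hf1i]
    · simp [hl, hp l]
  rw [e2] at R2
  refine R2.trans ?_
  obtain ⟨c, hc⟩ := ha
  obtain ⟨pc, qc, hpc⟩ := laurent_red hh0 c
  have hp'i : p' i = h := by simp [hp']
  have R3 : RelL (LaurentPolynomial.C τ) a (toLaurent ∘ p')
      (a + LaurentPolynomial.C τ * (Pi.single i qc ⬝ᵥ (toLaurent ∘ p'))) (toLaurent ∘ p') :=
    RelL.op1 _
  have e3 : a + LaurentPolynomial.C τ * (Pi.single i qc ⬝ᵥ (toLaurent ∘ p')) =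
      toLaurent (1 + Polynomial.C τ * pc) := by
    rw [single_dotProduct, Function.comp_apply, hp'i, map_add toLaurent 1, map_mul, toLaurent_C, hpc, map_one]
    linear_combination hc
  rw [e3] at R3
  refine R3.trans ?_
  have hu' : RelL.idl (1 + Polynomial.C τ * pc) p' = ⊤ := by
    refine poly_uni_of_laurent (i := i) ?_ (by rw [hp'i, hh0])
    rw [R3.idl_eq, R2.idl_eq, R1.idl_eq, hu]
  have := (suslin_poly hτ hid (a := 1 + Polynomial.C τ * pc) (f := p')
    ⟨pc, by ring⟩ hu' (by rw [hp'i]; exact hhm) (by rw [hp'i, hh0])).map toLaurent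
  rw [toLaurent_C, map_one] at this
  refine this.trans (RelL.refl' rfl ?_)
  ext1 l; simp

end


section LCoeff
open LaurentPolynomial
variable {Q : Type*} [CommRing Q]

theorem lcoeff_C_mul (r : Q) (b : Q[T;T⁻¹]) (n : ℤ) :
    (LaurentPolynomial.C r * b).coeff n = r * b.coeff n := by
  rw [← LaurentPolynomial.smul_eq_C_mul]; simp

theorem lcoeff_mul_T (b : Q[T;T⁻¹]) (n m : ℤ) : (b * T n).coeff m = b.coeff (m - n) := by
  induction b using LaurentPolynomial.induction_on' with
  | add p q hp hq => rw [add_mul, AddMonoidAlgebra.coeff_add, AddMonoidAlgebra.coeff_add]; simp [hp, hq]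
  | C_mul_T k a =>
    rw [mul_assoc, ← T_add, lcoeff_C_mul, lcoeff_C_mul, T_apply, T_apply]
    congr 1
    by_cases h : k + n = m
    · rw [if_pos h, if_pos (by omega)]
    · rw [if_neg h, if_neg (by omega)]

theorem lcoeff_toLaurent (p : Q[X]) (k : ℕ) : (toLaurent p).coeff (k : ℤ) = p.coeff k := by
  induction p using Polynomial.induction_on' with
  | add p q hp hq => rw [map_add, AddMonoidAlgebra.coeff_add, Polynomial.coeff_add, Finsupp.add_apply, hp, hq]
  | monomial n a =>
    rw [← Polynomial.C_mul_X_pow_eq_monomial, map_mul, toLaurent_C, toLaurent_X_pow, lcoeff_C_mul,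
      T_apply, Polynomial.coeff_C_mul, Polynomial.coeff_X_pow]
    simp [eq_comm]

theorem lcoeff_toLaurent_neg (p : Q[X]) (k : ℤ) (hk : k < 0) : (toLaurent p).coeff k = 0 := by
  induction p using Polynomial.induction_on' with
  | add p q hp hq => rw [map_add, AddMonoidAlgebra.coeff_add, Finsupp.add_apply, hp, hq, add_zero]
  | monomial n a =>
    rw [← Polynomial.C_mul_X_pow_eq_monomial, map_mul, toLaurent_C, toLaurent_X_pow, lcoeff_C_mul,
      T_apply, if_neg (by omega), mul_zero]

theorem lsum (b : Q[T;T⁻¹]) : b = ∑ n ∈ b.coeff.support, LaurentPolynomial.C (b.coeff n) * T n := by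
  ext m
  rw [AddMonoidAlgebra.coeff_sum]
  simp only [Finsupp.coe_finsetSum, Finset.sum_apply, lcoeff_C_mul, T_apply, mul_ite, mul_one, mul_zero,
    Finset.sum_ite_eq']
  simp

theorem mem_map_C_of_coeff {I : Ideal Q} {b : Q[T;T⁻¹]} (h : ∀ n, b.coeff n ∈ I) :
    b ∈ I.map (LaurentPolynomial.C : Q →+* Q[T;T⁻¹]) := by
  rw [lsum b]
  exact Ideal.sum_mem _ fun n _ => Ideal.mul_mem_right _ _ (Ideal.mem_map_of_mem _ (h n))

/-- relation between the coefficients of `b` and those of a polynomial multiple -/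
theorem lcoeff_poly {b : Q[T;T⁻¹]} {n : ℤ} {V : Q[X]} (h : toLaurent V = b * T n) :
    (∀ k : ℕ, V.coeff k = b.coeff (k - n)) ∧ ∀ j, b.coeff j = 0 ∨ ∃ k, V.coeff k = b.coeff j := by
  have h1 : ∀ k : ℕ, V.coeff k = b.coeff (k - n) := by
    intro k
    rw [← lcoeff_toLaurent, h, lcoeff_mul_T]
  refine ⟨h1, fun j => ?_⟩
  by_cases hj : 0 ≤ j + n
  · right
    obtain ⟨k, hk⟩ := Int.eq_ofNat_of_zero_le hj
    exact ⟨k, by rw [h1, ← hk]; congr 1; ring⟩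
  · left
    have := lcoeff_toLaurent_neg V (j + n) (by omega)
    rw [h, lcoeff_mul_T] at this
    rw [← this]; congr 1; ring

end LCoeff

section Kron
variable {B : Type*} [CommRing B]

/-- chains of `n + 1` primes above `K`, the top one avoiding `S` -/
def HasChain (S : Submonoid B) : ℕ → Ideal B → Prop
  | 0, K => ∃ P : Ideal B, P.IsPrime ∧ K ≤ P ∧ Disjoint (P : Set B) S
  | n + 1, K => ∃ P : Ideal B, P.IsPrime ∧ K ≤ P ∧ ∃ x, x ∉ P ∧ HasChain S n (P ⊔ Ideal.span {x})

theorem HasChain.anti {S : Submonoid B} {n : ℕ} {K L : Ideal B} (h : HasChain S n L) (hKL : K ≤ L) :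
    HasChain S n K := by
  cases n with
  | zero => obtain ⟨P, h1, h2, h3⟩ := h; exact ⟨P, h1, hKL.trans h2, h3⟩
  | succ n => obtain ⟨P, h1, h2, h3⟩ := h; exact ⟨P, h1, hKL.trans h2, h3⟩

theorem HasChain.bot {S : Submonoid B} {n : ℕ} {L : Ideal B} (h : HasChain S n L) :
    ∃ P : Ideal B, P.IsPrime ∧ L ≤ P ∧ HasChain S n P := by
  cases n with
  | zero => obtain ⟨P, h1, h2, h3⟩ := h; exact ⟨P, h1, h2, P, h1, le_rfl, h3⟩
  | succ n => obtain ⟨P, h1, h2, h3⟩ := h; exact ⟨P, h1, h2, P, h1, le_rfl, h3⟩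

def satIdeal (K : Ideal B) (b : B) : Ideal B where
  carrier := {y | ∃ N : ℕ, y * b ^ N ∈ K}
  zero_mem' := ⟨0, by simp⟩
  add_mem' := by
    rintro x y ⟨N, hN⟩ ⟨M, hM⟩
    refine ⟨N + M, ?_⟩
    have : (x + y) * b ^ (N + M) = b ^ M * (x * b ^ N) + b ^ N * (y * b ^ M) := by ring
    rw [this]
    exact add_mem (Ideal.mul_mem_left _ _ hN) (Ideal.mul_mem_left _ _ hM)
  smul_mem' := by
    rintro c x ⟨N, hN⟩
    refine ⟨N, ?_⟩
    rw [smul_eq_mul, mul_assoc]; exact Ideal.mul_mem_left _ _ hN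

theorem HasChain.step {S : Submonoid B} {n : ℕ} {K : Ideal B} {b : B}
    (h : HasChain S n (K ⊔ Ideal.span {b} ⊔ satIdeal K b)) : HasChain S (n + 1) K := by
  obtain ⟨P, hP, hle, hch⟩ := h.bot
  have hdis : Disjoint (K : Set B) (P.primeCompl ⊔ Submonoid.powers b : Submonoid B) := by
    rw [Set.disjoint_left]
    intro z hz hz'
    obtain ⟨y, hy, w, ⟨N, rfl⟩, rfl⟩ := Submonoid.mem_sup.1 hz'
    exact hy (hle (Ideal.mem_sup_right ⟨N, hz⟩))
  obtain ⟨p, hp, hKp, hpd⟩ := Ideal.exists_le_prime_disjoint _ _ hdis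
  rw [Set.disjoint_left] at hpd
  have hb : b ∉ p := fun h => hpd h (Submonoid.mem_sup_right (Submonoid.mem_powers b))
  refine ⟨p, hp, hKp, b, hb, hch.anti (sup_le ?_ ?_)⟩
  · intro x hx
    by_contra hxP
    exact hpd hx (Submonoid.mem_sup_left hxP)
  · exact le_trans (le_trans le_sup_right le_sup_left) hle

theorem kron (S : Submonoid B) : ∀ (n : ℕ) (K : Ideal B), ¬ HasChain S n K → ∀ (a : B) (b : Fin n → B),
    ∃ (x : Fin n → B) (s : B) (m : ℕ), s ∈ S ∧
      s * a ^ m ∈ K ⊔ Ideal.span (Set.range fun i => b i + a * x i) := by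
  intro n
  induction n with
  | zero =>
    intro K hK a b
    by_cases hd : Disjoint (K : Set B) S
    · obtain ⟨p, hp, h1, h2⟩ := Ideal.exists_le_prime_disjoint _ _ hd
      exact absurd ⟨p, hp, h1, h2⟩ hK
    · rw [Set.not_disjoint_iff] at hd
      obtain ⟨s, h1, h2⟩ := hd
      exact ⟨0, s, 0, h2, Ideal.mem_sup_left (by simpa using h1)⟩
  | succ n ih =>
    intro K hK a b
    obtain ⟨x, s, m, hs, hmem⟩ := ih (K ⊔ Ideal.span {b 0} ⊔ satIdeal K (b 0))
      (fun h => hK h.step) a (fun i => b i.succ)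
    obtain ⟨z, hz, σ, hσ, hzs⟩ := Submodule.mem_sup.1 hmem
    obtain ⟨z', hz', y, ⟨N, hy⟩, rfl⟩ := Submodule.mem_sup.1 hz
    set L := K ⊔ Ideal.span (Set.range fun i => b i + a * (Fin.cons y x : Fin (n+1) → B) i) with hL
    have hrad : s * a ^ (m + 1) ∈ L.radical := by
      rw [Ideal.radical_eq_sInf, Submodule.mem_sInf]
      rintro 𝔓 ⟨hL𝔓, h𝔓⟩
      have hK𝔓 : K ≤ 𝔓 := le_sup_left.trans hL𝔓
      have h0 : b 0 + a * y ∈ 𝔓 := hL𝔓 (Ideal.mem_sup_right (Ideal.subset_span ⟨0, by simp⟩))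
      have hσ' : σ ∈ 𝔓 := by
        refine (Ideal.span_le.2 ?_ : _ ≤ 𝔓) hσ
        rintro _ ⟨i, rfl⟩
        exact hL𝔓 (Ideal.mem_sup_right (Ideal.subset_span ⟨i.succ, by simp⟩))
      have hby : b 0 ∈ 𝔓 ∧ a * y ∈ 𝔓 := by
        rcases h𝔓.mem_or_mem (hK𝔓 hy) with h | h
        · have h1 : a * y ∈ 𝔓 := Ideal.mul_mem_left _ _ h
          exact ⟨(Ideal.add_mem_iff_left _ h1).1 h0, h1⟩
        · have h1 := h𝔓.mem_of_pow_mem _ h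
          exact ⟨h1, (Ideal.add_mem_iff_right _ h1).1 h0⟩
      have hz'' : z' ∈ 𝔓 := (sup_le hK𝔓 (by
        rw [Ideal.span_singleton_le_iff_mem]; exact hby.1)) hz'
      have e : s * a ^ (m + 1) = a * z' + a * y + a * σ := by
        rw [pow_succ, ← mul_assoc, ← hzs]; ring
      rw [e]
      exact add_mem (add_mem (Ideal.mul_mem_left _ _ hz'') hby.2) (Ideal.mul_mem_left _ _ hσ')
    obtain ⟨M, hM⟩ := hrad
    refine ⟨Fin.cons y x, s ^ M, (m + 1) * M, S.pow_mem hs M, ?_⟩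
    rw [mul_pow, ← pow_mul] at hM
    exact hM

end Kron

section Dim
open LaurentPolynomial
variable {Q : Type*} [CommRing Q]

theorem laurent_comap_lt {𝔓 𝔓' : Ideal Q[T;T⁻¹]} [h𝔓 : 𝔓.IsPrime] (hle : 𝔓 ≤ 𝔓') {r : Q[T;T⁻¹]}
    (hr : r ∈ 𝔓') (hr' : r ∉ 𝔓) {v : Q[T;T⁻¹]} (hv : v ∈ 𝔓) {k : ℤ}
    (hk : LaurentPolynomial.C (v.coeff k) ∉ 𝔓) :
    𝔓.comap (LaurentPolynomial.C : Q →+* Q[T;T⁻¹]) < 𝔓'.comap LaurentPolynomial.C := by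
  set φ : Q →+* Q[T;T⁻¹] := LaurentPolynomial.C with hφ
  obtain ⟨n, V, hV⟩ := v.exists_T_pow
  obtain ⟨n', p', hp'⟩ := r.exists_T_pow
  have hV𝔓 : toLaurent V ∈ 𝔓 := by rw [hV]; exact Ideal.mul_mem_right _ _ hv
  have hunit : ∀ (n : ℤ), (T n : Q[T;T⁻¹]) ∉ 𝔓 := fun n h => h𝔓.ne_top
    (Ideal.eq_top_of_isUnit_mem _ h (isUnit_T n))
  have hp1 : toLaurent p' ∈ 𝔓' := by rw [hp']; exact Ideal.mul_mem_right _ _ hr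
  have hp2 : toLaurent p' ∉ 𝔓 := by
    rw [hp']; intro h
    rcases h𝔓.mem_or_mem h with h | h
    · exact hr' h
    · exact hunit _ h
  set 𝔭 := 𝔓.comap φ with h𝔭
  letI : Algebra (Q ⧸ 𝔭) (Q[T;T⁻¹] ⧸ 𝔓) := Ideal.Quotient.algebraQuotientOfLEComap le_rfl
  have halg : ∀ x, algebraMap (Q ⧸ 𝔭) (Q[T;T⁻¹] ⧸ 𝔓) (Ideal.Quotient.mk 𝔭 x) =
    Ideal.Quotient.mk 𝔓 (φ x) := fun x => rfl
  have haeval : ∀ (p : Q[X]) (z : Q[T;T⁻¹]), aeval (Ideal.Quotient.mk 𝔓 z) (p.map (Ideal.Quotient.mk 𝔭)) =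
    Ideal.Quotient.mk 𝔓 (p.eval₂ φ z) := by
    intro p z
    rw [aeval_def, eval₂_map, hom_eval₂]; rfl
  have heval : ∀ p : Q[X], p.eval₂ φ (T 1) = toLaurent p := by
    intro p
    have : eval₂RingHom φ (T 1 : Q[T;T⁻¹]) = toLaurent := by
      ext <;> simp [hφ]
    exact congrArg (fun h => h p) this
  have hT : IsAlgebraic (Q ⧸ 𝔭) (Ideal.Quotient.mk 𝔓 (T 1)) := by
    refine ⟨V.map (Ideal.Quotient.mk 𝔭), ?_, ?_⟩
    · intro h0
      rcases (lcoeff_poly hV).2 k with h | ⟨l, hl⟩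
      · rw [h] at hk; simp at hk
      · apply hk
        rw [← hl]
        have := congrArg (fun p => p.coeff l) h0
        simp only [coeff_map, coeff_zero] at this
        exact (Ideal.Quotient.eq_zero_iff_mem (I := 𝔭)).1 this
    · rw [haeval, heval]
      exact Ideal.Quotient.eq_zero_iff_mem.2 hV𝔓
  have hpalg : IsAlgebraic (Q ⧸ 𝔭) (Ideal.Quotient.mk 𝔓 (toLaurent p')) := by
    rw [← heval, ← haeval]
    have h1 : (Ideal.Quotient.mk 𝔓 (T 1)) ∈ Subalgebra.algebraicClosure (Q ⧸ 𝔭) (Q[T;T⁻¹] ⧸ 𝔓) := hT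
    exact Algebra.adjoin_le (Set.singleton_subset_iff.2 h1)
      (Polynomial.aeval_mem_adjoin_singleton (Q ⧸ 𝔭) (p := p'.map (Ideal.Quotient.mk 𝔭)) _)
  obtain ⟨p, hp0, hp⟩ := hpalg
  obtain ⟨p, rfl⟩ := Polynomial.map_surjective _ Ideal.Quotient.mk_surjective p
  rw [haeval] at hp
  exact Ideal.comap_lt_comap_of_root_mem_sdiff hle ⟨hp1, hp2⟩ hp0
    (Ideal.Quotient.eq_zero_iff_mem.1 hp)

theorem HasChain.series {S : Submonoid Q} {v : Q[T;T⁻¹]}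
    (hprim : ∀ q : Ideal Q, q.IsPrime → ∃ k, v.coeff k ∉ q) :
    ∀ (n : ℕ) (K : Ideal Q[T;T⁻¹]), v ∈ K →
    HasChain (S.map (LaurentPolynomial.C : Q →+* Q[T;T⁻¹])) n K →
    ∃ l : LTSeries (PrimeSpectrum Q), l.length = n ∧ 
      (∃ P : Ideal Q[T;T⁻¹], K ≤ P ∧ l.head.asIdeal = P.comap LaurentPolynomial.C) ∧
      Disjoint (l.last.asIdeal : Set Q) S := by
  intro n
  induction n with
  | zero =>
    rintro K hv ⟨P, hP, hKP, hd⟩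
    refine ⟨RelSeries.singleton _ ⟨P.comap LaurentPolynomial.C, hP.comap _⟩, rfl, ⟨P, hKP, rfl⟩, ?_⟩
    rw [Set.disjoint_left] at hd ⊢
    intro x hx hxS
    exact hd hx ⟨x, hxS, rfl⟩
  | succ n ih =>
    rintro K hv ⟨P, hP, hKP, x, hx, hch⟩
    obtain ⟨l, hl, ⟨P', hP', hhead⟩, hlast⟩ := ih _ (Ideal.mem_sup_left (hKP hv)) hch
    have hlt : P.comap LaurentPolynomial.C < l.head.asIdeal := by
      rw [hhead]
      obtain ⟨k, hk⟩ := hprim (P.comap LaurentPolynomial.C) (hP.comap _)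
      exact laurent_comap_lt (le_sup_left.trans hP') (hP' (Ideal.mem_sup_right
        (Ideal.mem_span_singleton_self x))) hx (hKP hv) hk
    refine ⟨l.cons ⟨P.comap LaurentPolynomial.C, hP.comap _⟩ hlt, by simp [hl], ⟨P, hKP, ?_⟩, ?_⟩
    · rw [RelSeries.head_cons]
    · rw [RelSeries.last_cons]; exact hlast

def strMonoid (e : Q) : Submonoid Q where
  carrier := {s | ∃ (k : ℕ) (y : Q), s = e ^ k * (1 + e * y)}
  one_mem' := ⟨0, 0, by simp⟩
  mul_mem' := by
    rintro _ _ ⟨k, y, rfl⟩ ⟨l, z, rfl⟩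
    exact ⟨k + l, y + z + e * y * z, by ring⟩

theorem not_hasChain {d : ℕ} (hd : ringKrullDim Q ≤ d) (e : Q) {v : Q[T;T⁻¹]}
    (hprim : ∀ q : Ideal Q, q.IsPrime → ∃ k, v.coeff k ∉ q) {K : Ideal Q[T;T⁻¹]} (hv : v ∈ K) :
    ¬ HasChain ((strMonoid e).map (LaurentPolynomial.C : Q →+* Q[T;T⁻¹])) d K := by
  intro h
  obtain ⟨l, hl, -, hdis⟩ := h.series hprim _ _ hv
  rw [Set.disjoint_left] at hdis
  have he : e ∉ l.last.asIdeal := fun h => hdis h ⟨1, 0, by simp⟩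
  have hne : l.last.asIdeal ⊔ Ideal.span {e} ≠ ⊤ := by
    intro htop
    have h1 : (1 : Q) ∈ l.last.asIdeal ⊔ Ideal.span {e} := by rw [htop]; trivial
    obtain ⟨u, hu, w, hw, huw⟩ := Submodule.mem_sup.1 h1
    obtain ⟨y, rfl⟩ := Ideal.mem_span_singleton'.1 hw
    exact hdis hu ⟨0, -y, by rw [pow_zero, one_mul]; linear_combination huw⟩
  obtain ⟨m, hm, hle⟩ := Ideal.exists_le_maximal _ hne
  have hlt : l.last < ⟨m, hm.isPrime⟩ := by
    refine lt_of_le_of_ne (le_sup_left.trans hle) ?_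
    intro heq
    apply he
    rw [heq]
    exact hle (Ideal.mem_sup_right (Ideal.mem_span_singleton_self _))
  have := Order.LTSeries.length_le_krullDim (l.snoc ⟨m, hm.isPrime⟩ hlt)
  rw [RelSeries.snoc_length, hl] at this
  have h2 := this.trans hd
  have h3 : d + 1 ≤ d := by exact_mod_cast h2
  omega

end Dim



section Strat
open LaurentPolynomial
variable {Q : Type*} [CommRing Q]

def Good (J : Ideal Q[T;T⁻¹]) : List Q → Ideal Q → Q → Prop
  | [], I, e => ∃ s ∈ strMonoid e, (LaurentPolynomial.C s : Q[T;T⁻¹]) ∈ J ⊔ I.map LaurentPolynomial.C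
  | c :: cs, I, e => Good J cs (I ⊔ Ideal.span {c}) e ∧ Good J cs I (e * c)

theorem Good.mono {J J' : Ideal Q[T;T⁻¹]} : ∀ {cs : List Q} {I : Ideal Q} {e : Q},
    J ≤ J' ⊔ I.map (LaurentPolynomial.C : Q →+* Q[T;T⁻¹]) → Good J cs I e → Good J' cs I e := by
  intro cs
  induction cs with
  | nil =>
    rintro I e h ⟨s, hs, hm⟩
    exact ⟨s, hs, (sup_le h le_sup_right) hm⟩
  | cons c cs ih =>
    rintro I e h ⟨h1, h2⟩
    exact ⟨ih (h.trans (sup_le_sup_left (Ideal.map_mono le_sup_left) _)) h1, ih h h2⟩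

theorem Good.extract {J : Ideal Q[T;T⁻¹]} {𝔓 : Ideal Q[T;T⁻¹]} (h𝔓 : 𝔓.IsPrime) (hJ : J ≤ 𝔓)
    {m : Ideal Q} (hm : m ≠ ⊤) (hqm : 𝔓.comap (LaurentPolynomial.C : Q →+* Q[T;T⁻¹]) ≤ m) :
    ∀ {cs : List Q} {I : Ideal Q} {e : Q}, Good J cs I e →
      I ≤ 𝔓.comap (LaurentPolynomial.C : Q →+* Q[T;T⁻¹]) →
      e ∉ 𝔓.comap (LaurentPolynomial.C : Q →+* Q[T;T⁻¹]) →
      e ∉ m ∧ ∀ c ∈ cs, c ∈ m → c ∈ 𝔓.comap (LaurentPolynomial.C : Q →+* Q[T;T⁻¹]) := by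
  have hq : (𝔓.comap (LaurentPolynomial.C : Q →+* Q[T;T⁻¹])).IsPrime := h𝔓.comap _
  intro cs
  induction cs with
  | nil =>
    rintro I e ⟨_, ⟨k, y, rfl⟩, hmem⟩ hI he
    refine ⟨fun hem => ?_, by simp⟩
    have h1 : e ^ k * (1 + e * y) ∈ 𝔓.comap (LaurentPolynomial.C : Q →+* Q[T;T⁻¹]) :=
      (sup_le hJ (Ideal.map_le_iff_le_comap.2 hI)) hmem
    rcases hq.mem_or_mem h1 with h | h
    · exact he (hq.mem_of_pow_mem _ h)
    · refine hm ((Ideal.eq_top_iff_one _).2 ?_)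
      exact (Ideal.add_mem_iff_left _ (Ideal.mul_mem_right _ _ hem)).1 (hqm h)
  | cons c cs ih =>
    rintro I e ⟨h1, h2⟩ hI he
    by_cases hc : c ∈ 𝔓.comap (LaurentPolynomial.C : Q →+* Q[T;T⁻¹])
    · obtain ⟨h3, h4⟩ := ih h1 (sup_le hI ((Ideal.span_singleton_le_iff_mem _).2 hc)) he
      refine ⟨h3, ?_⟩
      intro b hb
      rcases List.mem_cons.1 hb with rfl | hb
      · exact fun _ => hc
      · exact h4 b hb
    · obtain ⟨h3, h4⟩ := ih h2 hI (fun h => (hq.mem_or_mem h).elim he hc)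
      refine ⟨fun h => h3 (Ideal.mul_mem_right _ _ h), ?_⟩
      intro b hb
      rcases List.mem_cons.1 hb with rfl | hb
      · exact fun h => absurd (Ideal.mul_mem_left _ _ h) h3
      · exact h4 b hb

theorem strat {d : ℕ} (hd : ringKrullDim Q ≤ d) {v h : Q[T;T⁻¹]}
    (hprim : ∀ q : Ideal Q, q.IsPrime → ∃ k, v.coeff k ∉ q) : ∀ (cs : List Q) (I : Ideal Q) (e : Q)
    (g : Fin d → Q[T;T⁻¹]),
    1 ∈ Ideal.span {v} ⊔ Ideal.span (Set.range g) ⊔ Ideal.span {h} →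
    ∃ x : Fin d → Q[T;T⁻¹], Good (Ideal.span {v} ⊔ Ideal.span (Set.range fun i =>
      g i + (LaurentPolynomial.C e * h) * x i)) cs I e := by
  intro cs
  induction cs with
  | nil =>
    intro I e g hu
    obtain ⟨x, s, m, ⟨s', hs', rfl⟩, hmem⟩ := kron ((strMonoid e).map (LaurentPolynomial.C : Q →+* Q[T;T⁻¹])) d
      (Ideal.span {v} ⊔ I.map LaurentPolynomial.C)
      (not_hasChain hd e hprim (Ideal.mem_sup_left (Ideal.mem_span_singleton_self v)))
      (LaurentPolynomial.C e * h) g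
    refine ⟨x, s' * e ^ m, mul_mem hs' ⟨m, 0, by simp⟩, ?_⟩
    set L := Ideal.span {v} ⊔ Ideal.span (Set.range fun i =>
      g i + (LaurentPolynomial.C e * h) * x i) ⊔ I.map LaurentPolynomial.C with hL
    have hmem' : LaurentPolynomial.C s' * (LaurentPolynomial.C e * h) ^ m ∈ L := by
      refine (sup_le (sup_le ?_ ?_) ?_ : _ ≤ L) hmem
      · exact le_sup_left.trans le_sup_left
      · exact le_sup_right
      · exact le_sup_right.trans le_sup_left
    have hu' : 1 ∈ L ⊔ Ideal.span {h} := by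
      refine (sup_le (sup_le ?_ ?_) le_sup_right : _ ≤ L ⊔ Ideal.span {h}) hu
      · exact (le_sup_left.trans le_sup_left).trans le_sup_left
      · rw [Ideal.span_le]
        rintro _ ⟨i, rfl⟩
        have h1 : g i + (LaurentPolynomial.C e * h) * x i ∈ L ⊔ Ideal.span {h} :=
          Ideal.mem_sup_left (Ideal.mem_sup_left (Ideal.mem_sup_right (Ideal.subset_span ⟨i, rfl⟩)))
        have h2 : (LaurentPolynomial.C e * h) * x i ∈ L ⊔ Ideal.span {h} :=
          Ideal.mul_mem_right _ _ (Ideal.mul_mem_left _ _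
            (Ideal.mem_sup_right (Ideal.mem_span_singleton_self h)))
        exact (Ideal.add_mem_iff_left _ h2).1 h1
    obtain ⟨l, hl, w, hw, hlw⟩ := Submodule.mem_sup.1 hu'
    obtain ⟨z, rfl⟩ := Ideal.mem_span_singleton'.1 hw
    have h3 : (1 : Q[T;T⁻¹]) - (z * h) ^ m ∈ L := by
      have : (1 - z * h) ∣ (1 : Q[T;T⁻¹]) ^ m - (z * h) ^ m := sub_dvd_pow_sub_pow _ _ _
      rw [one_pow] at this
      refine Ideal.mem_of_dvd _ this ?_
      rw [← hlw]; simpa using hl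
    have e1 : (LaurentPolynomial.C (s' * e ^ m) : Q[T;T⁻¹]) =
        LaurentPolynomial.C (s' * e ^ m) * (1 - (z * h) ^ m) +
        z ^ m * (LaurentPolynomial.C s' * (LaurentPolynomial.C e * h) ^ m) := by
      simp only [map_mul, map_pow]; ring
    rw [e1]
    exact add_mem (Ideal.mul_mem_left _ _ h3) (Ideal.mul_mem_left _ _ hmem')
  | cons c cs ih =>
    intro I e g hu
    obtain ⟨x, hx⟩ := ih (I ⊔ Ideal.span {c}) e g hu
    have hu' : 1 ∈ Ideal.span {v} ⊔ Ideal.span (Set.range fun i =>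
      g i + (LaurentPolynomial.C e * h) * x i) ⊔ Ideal.span {h} := by
      suffices hle : Ideal.span {v} ⊔ Ideal.span (Set.range g) ⊔ Ideal.span {h} ≤ Ideal.span {v} ⊔
        Ideal.span (Set.range fun i => g i + (LaurentPolynomial.C e * h) * x i) ⊔ Ideal.span {h} from hle hu
      refine sup_le (sup_le ?_ ?_) le_sup_right
      · exact le_sup_left.trans le_sup_left
      · rw [Ideal.span_le]
        rintro _ ⟨i, rfl⟩
        have h1 := Ideal.mem_sup_left (T := Ideal.span {h}) (Ideal.mem_sup_right (S := Ideal.span {v})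
          (Ideal.subset_span (s := Set.range fun i =>
            g i + (LaurentPolynomial.C e * h) * x i) ⟨i, rfl⟩))
        refine (Ideal.add_mem_iff_left _ ?_).1 h1
        exact Ideal.mul_mem_right _ _ (Ideal.mul_mem_left _ _
            (Ideal.mem_sup_right (Ideal.mem_span_singleton_self h)))
    obtain ⟨x', hx'⟩ := ih I (e * c) _ hu'
    refine ⟨fun i => x i + LaurentPolynomial.C c * x' i, ?_, ?_⟩
    · refine Good.mono (sup_le (le_sup_left.trans le_sup_left) ?_) hx
      rw [Ideal.span_le]
      rintro _ ⟨i, rfl⟩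
      have h1 : (g i + (LaurentPolynomial.C e * h) * x i) =
        (g i + (LaurentPolynomial.C e * h) * (x i + LaurentPolynomial.C c * x' i)) +
        (- (LaurentPolynomial.C e * h) * x' i) * LaurentPolynomial.C c := by ring
      show g i + (LaurentPolynomial.C e * h) * x i ∈ _
      rw [h1]
      refine add_mem (Ideal.mem_sup_left (Ideal.mem_sup_right (Ideal.subset_span ⟨i, rfl⟩)))
        (Ideal.mem_sup_right (Ideal.mul_mem_left _ _ (Ideal.mem_map_of_mem _
          (Ideal.mem_sup_right (Ideal.mem_span_singleton_self c)))))
    · have e1 : (fun i => g i + (LaurentPolynomial.C e * h) * (x i + LaurentPolynomial.C c * x' i)) =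
        fun i => g i + (LaurentPolynomial.C e * h) * x i + LaurentPolynomial.C (e * c) * h * x' i := by
        funext i; rw [map_mul]; ring
      rw [e1]; exact hx'

theorem comonic {J : Ideal Q[T;T⁻¹]} {v : Q[T;T⁻¹]} (hv : v ∈ J)
    (hprim : ∀ q : Ideal Q, q.IsPrime → ∃ k, v.coeff k ∉ q)
    (hG : ∀ 𝔓 : Ideal Q[T;T⁻¹], 𝔓.IsPrime → J ≤ 𝔓 → ∀ m : Ideal Q, m ≠ ⊤ →
      𝔓.comap (LaurentPolynomial.C : Q →+* Q[T;T⁻¹]) ≤ m → ∀ k, v.coeff k ∈ m →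
      LaurentPolynomial.C (v.coeff k) ∈ 𝔓) :
    ∃ p : Q[X], toLaurent p ∈ J ∧ p.coeff 0 = 1 := by
  classical
  obtain ⟨n, V, hV⟩ := v.exists_T_pow
  obtain ⟨hc1, hc2⟩ := lcoeff_poly hV
  have hVJ : toLaurent V ∈ J := by rw [hV]; exact Ideal.mul_mem_right _ _ hv
  let D : Ideal Q := (J.comap (toLaurent : Q[X] →+* Q[T;T⁻¹])).map Polynomial.constantCoeff
  have hD : ∀ c ∈ D, ∃ p : Q[X], toLaurent p ∈ J ∧ p.coeff 0 = c := by
    intro c hc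
    have hs : Function.Surjective (Polynomial.constantCoeff : Q[X] →+* Q) := fun c => ⟨Polynomial.C c, by simp⟩
    obtain ⟨p, hp, rfl⟩ := (Ideal.mem_map_iff_of_surjective _ hs).1 hc
    exact ⟨p, hp, rfl⟩
  have hD' : ∀ p : Q[X], toLaurent p ∈ J → p.coeff 0 ∈ D := fun p hp =>
    Ideal.mem_map_of_mem Polynomial.constantCoeff hp
  by_contra hcon
  have hDtop : D ≠ ⊤ := fun h => hcon (hD 1 (by rw [h]; trivial))
  obtain ⟨m, hm, hDm⟩ := Ideal.exists_le_maximal _ hDtop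
  have hmp := hm.isPrime
  have hex : ∃ k, V.coeff k ∉ m := by
    obtain ⟨k, hk⟩ := hprim m hmp
    rcases hc2 k with h | ⟨j, hj⟩
    · rw [h] at hk; exact absurd m.zero_mem hk
    · exact ⟨j, by rwa [hj]⟩
  set i0 := Nat.find hex with hi0
  have hi1 : V.coeff i0 ∉ m := Nat.find_spec hex
  have hi2 : ∀ k < i0, V.coeff k ∈ m := fun k hk => not_not.1 (Nat.find_min hex hk)
  set U : Q[X] := ∑ k ∈ Finset.range i0, Polynomial.C (V.coeff k) * X ^ k with hU
  have hUc : ∀ j, U.coeff j = if j < i0 then V.coeff j else 0 := by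
    intro j
    rw [hU, Polynomial.finsetSum_coeff]
    simp [Polynomial.coeff_C_mul, Polynomial.coeff_X_pow]
  obtain ⟨W, hW⟩ : X ^ i0 ∣ V - U := by
    rw [Polynomial.X_pow_dvd_iff]
    intro k hk
    rw [Polynomial.coeff_sub, hUc, if_pos hk, sub_self]
  have hW0 : W.coeff 0 ∉ m := by
    have := congrArg (fun p => Polynomial.coeff p i0) hW
    simp only [Polynomial.coeff_sub, hUc, lt_irrefl, if_false, sub_zero, Polynomial.coeff_X_pow_mul', le_refl,
      if_true, Nat.sub_self] at this
    rwa [← this]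
  by_cases hdis : Disjoint (J : Set Q[T;T⁻¹]) (m.primeCompl.map (LaurentPolynomial.C : Q →+* Q[T;T⁻¹]) ⊔
      Submonoid.powers (toLaurent W) : Submonoid _)
  · obtain ⟨𝔓, h𝔓, hJ𝔓, hd⟩ := Ideal.exists_le_prime_disjoint _ _ hdis
    rw [Set.disjoint_left] at hd
    have hW𝔓 : toLaurent W ∉ 𝔓 := fun h => hd h (Submonoid.mem_sup_right (Submonoid.mem_powers _))
    have hle : 𝔓.comap (LaurentPolynomial.C : Q →+* Q[T;T⁻¹]) ≤ m := by
      intro x hx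
      by_contra hxm
      exact hd hx (Submonoid.mem_sup_left ⟨x, hxm, rfl⟩)
    have hU𝔓 : toLaurent U ∈ 𝔓 := by
      rw [hU, map_sum]
      refine Ideal.sum_mem _ fun k hk => ?_
      rw [map_mul, toLaurent_C]
      refine Ideal.mul_mem_right _ _ ?_
      rw [hc1]
      refine hG 𝔓 h𝔓 hJ𝔓 m hm.ne_top hle _ ?_
      rw [← hc1]
      exact hi2 k (Finset.mem_range.1 hk)
    have : toLaurent (X ^ i0 * W) ∈ 𝔓 := by
      rw [← hW, map_sub]; exact sub_mem (hJ𝔓 hVJ) hU𝔓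
    rw [map_mul, toLaurent_X_pow] at this
    rcases h𝔓.mem_or_mem this with h | h
    · exact h𝔓.ne_top (Ideal.eq_top_of_isUnit_mem _ h (isUnit_T _))
    · exact hW𝔓 h
  · rw [Set.not_disjoint_iff] at hdis
    obtain ⟨z, hz, hz'⟩ := hdis
    obtain ⟨_, ⟨s, hs, rfl⟩, _, ⟨K, rfl⟩, rfl⟩ := Submonoid.mem_sup.1 hz'
    have h1 : toLaurent (Polynomial.C s * W ^ K) ∈ J := by
      rw [map_mul, toLaurent_C, map_pow]; exact hz
    have h2 := hDm (hD' _ h1)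
    rw [Polynomial.mul_coeff_zero, Polynomial.coeff_C_zero, Polynomial.coeff_zero_eq_eval_zero,
      Polynomial.eval_pow, ← Polynomial.coeff_zero_eq_eval_zero] at h2
    rcases hmp.mem_or_mem h2 with h | h
    · exact hs h
    · exact hW0 (hmp.mem_of_pow_mem _ h)

end Strat



section Core
open LaurentPolynomial
variable {Q : Type*} [CommRing Q]

noncomputable def lmap {Q' : Type*} [CommRing Q'] (g : Q →+* Q') : Q[T;T⁻¹] →+* Q'[T;T⁻¹] :=
  AddMonoidAlgebra.mapRingHom ℤ g

theorem lmap_coeff {Q' : Type*} [CommRing Q'] (g : Q →+* Q') (b : Q[T;T⁻¹]) (n : ℤ) :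
    (lmap g b).coeff n = g (b.coeff n) := by
  simp [lmap]

theorem lmap_C {Q' : Type*} [CommRing Q'] (g : Q →+* Q') (x : Q) :
    lmap g (LaurentPolynomial.C x) = LaurentPolynomial.C (g x) := by
  ext n
  rw [lmap_coeff, C_apply, C_apply]; split_ifs <;> simp

theorem lmap_T {Q' : Type*} [CommRing Q'] (g : Q →+* Q') (n : ℤ) :
    lmap g (T n) = T n := by
  ext k
  rw [lmap_coeff, T_apply, T_apply]; split_ifs <;> simp

theorem mem_map_C_iff {I : Ideal Q} {b : Q[T;T⁻¹]} :
    b ∈ I.map (LaurentPolynomial.C : Q →+* Q[T;T⁻¹]) ↔ ∀ n, b.coeff n ∈ I := by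
  refine ⟨fun h n => ?_, mem_map_C_of_coeff⟩
  have hle : I.map (LaurentPolynomial.C : Q →+* Q[T;T⁻¹]) ≤ RingHom.ker (lmap (Ideal.Quotient.mk I)) := by
    rw [Ideal.map_le_iff_le_comap]
    intro x hx
    rw [Ideal.mem_comap, RingHom.mem_ker, lmap_C, Ideal.Quotient.eq_zero_iff_mem.2 hx, map_zero]
  have := hle h
  rw [RingHom.mem_ker] at this
  rw [← Ideal.Quotient.eq_zero_iff_mem, ← lmap_coeff, this]; rfl

theorem ker_lmap (I : Ideal Q) : RingHom.ker (lmap (Ideal.Quotient.mk I)) =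
    I.map (LaurentPolynomial.C : Q →+* Q[T;T⁻¹]) := by
  ext b
  rw [mem_map_C_iff, RingHom.mem_ker]
  constructor
  · intro h n
    rw [← Ideal.Quotient.eq_zero_iff_mem, ← lmap_coeff, h]; rfl
  · intro h
    ext n
    rw [lmap_coeff, Ideal.Quotient.eq_zero_iff_mem.2 (h n)]; rfl

theorem lmap_surj {Q' : Type*} [CommRing Q'] (g : Q →+* Q') (hg : Function.Surjective g) :
    Function.Surjective (lmap g) := by
  intro b
  induction b using LaurentPolynomial.induction_on' with
  | add p q hp hq =>
    obtain ⟨x, rfl⟩ := hp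
    obtain ⟨y, rfl⟩ := hq
    exact ⟨x + y, map_add _ _ _⟩
  | C_mul_T k a =>
    obtain ⟨x, rfl⟩ := hg a
    exact ⟨LaurentPolynomial.C x * T k, by rw [map_mul, lmap_C, lmap_T]⟩

theorem lcoeff_bound (a : Q[T;T⁻¹]) : ∃ M : ℕ, ∀ n : ℤ, M < n.natAbs → a.coeff n = 0 := by
  refine ⟨a.coeff.support.sup Int.natAbs, fun n hn => ?_⟩
  by_contra h
  have := Finset.le_sup (f := Int.natAbs) (Finsupp.mem_support_iff.2 h)
  omega

theorem prim_step1 (τ : Q) (a b : Q[T;T⁻¹]) : ∃ N : ℤ, ∀ q : Ideal Q, q.IsPrime → τ ∉ q →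
    (∀ k, (a + LaurentPolynomial.C τ * (T N * b)).coeff k ∈ q) →
    (∀ k, a.coeff k ∈ q) ∧ ∀ k, b.coeff k ∈ q := by
  obtain ⟨M1, h1⟩ := lcoeff_bound a
  obtain ⟨M2, h2⟩ := lcoeff_bound b
  refine ⟨2 * (M1 + M2 : ℕ) + 1, fun q hq hτ h => ?_⟩
  have hk : ∀ k, a.coeff k + τ * b.coeff (k - (2 * (M1 + M2 : ℕ) + 1)) ∈ q := by
    intro k
    have := h k
    rwa [AddMonoidAlgebra.coeff_add, Finsupp.add_apply, lcoeff_C_mul, mul_comm (T _), lcoeff_mul_T] at this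
  have ha : ∀ k, a.coeff k ∈ q := by
    intro k
    by_cases hkM : M1 < k.natAbs
    · rw [h1 k hkM]; exact q.zero_mem
    · have := hk k
      rwa [h2 _ (by omega), mul_zero, add_zero] at this
  refine ⟨ha, fun j => ?_⟩
  have := hk (j + (2 * (M1 + M2 : ℕ) + 1))
  rw [add_sub_cancel_right, Ideal.add_mem_iff_right _ (ha _)] at this
  exact (hq.mem_or_mem this).resolve_left hτ

theorem prim_step {ι : Type*} [Fintype ι] [DecidableEq ι] {τ : Q} {a : Q[T;T⁻¹]} {f : ι → Q[T;T⁻¹]}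
    (ha : LaurentPolynomial.C τ ∣ a - 1) (hu : RelL.idl a f = ⊤) :
    ∃ φ : ι → Q[T;T⁻¹], ∀ q : Ideal Q, q.IsPrime →
      ∃ k, (a + LaurentPolynomial.C τ * (φ ⬝ᵥ f)).coeff k ∉ q := by
  have key : ∀ s : Finset ι, ∃ φ : ι → Q[T;T⁻¹], ∀ q : Ideal Q, q.IsPrime → τ ∉ q →
      (∀ k, (a + LaurentPolynomial.C τ * (φ ⬝ᵥ f)).coeff k ∈ q) →
      (∀ k, a.coeff k ∈ q) ∧ ∀ i ∈ s, ∀ k, (f i).coeff k ∈ q := by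
    intro s
    induction s using Finset.induction_on with
    | empty => exact ⟨0, fun q _ _ h => ⟨by simpa using h, by simp⟩⟩
    | insert i s _ ih =>
      obtain ⟨φ, hφ⟩ := ih
      obtain ⟨N, hN⟩ := prim_step1 τ (a + LaurentPolynomial.C τ * (φ ⬝ᵥ f)) (f i)
      refine ⟨φ + Pi.single i (T N), fun q hq hτ h => ?_⟩
      rw [add_dotProduct, single_dotProduct, mul_add, ← add_assoc] at h
      obtain ⟨h1, h2⟩ := hN q hq hτ h
      obtain ⟨h3, h4⟩ := hφ q hq hτ h1
      refine ⟨h3, fun j hj => ?_⟩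
      rcases Finset.mem_insert.1 hj with rfl | hj
      · exact h2
      · exact h4 j hj
  obtain ⟨φ, hφ⟩ := key Finset.univ
  refine ⟨φ, fun q hq => ?_⟩
  by_contra! hcon
  by_cases hτ : τ ∈ q
  · obtain ⟨c, hc⟩ := ha
    have h1 : a + LaurentPolynomial.C τ * (φ ⬝ᵥ f) - LaurentPolynomial.C τ * (c + φ ⬝ᵥ f) = 1 := by
      linear_combination hc
    have h2 : a + LaurentPolynomial.C τ * (φ ⬝ᵥ f) - LaurentPolynomial.C τ * (c + φ ⬝ᵥ f) ∈
        q.map (LaurentPolynomial.C : Q →+* Q[T;T⁻¹]) :=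
      sub_mem (mem_map_C_iff.2 hcon) (Ideal.mul_mem_right _ _ (Ideal.mem_map_of_mem _ hτ))
    rw [h1, mem_map_C_iff] at h2
    have := h2 0
    rw [← map_one LaurentPolynomial.C, C_apply, if_pos rfl] at this
    exact hq.ne_top ((Ideal.eq_top_iff_one _).2 this)
  · obtain ⟨h1, h2⟩ := hφ q hq hτ hcon
    have h3 : RelL.idl a f ≤ q.map (LaurentPolynomial.C : Q →+* Q[T;T⁻¹]) :=
      RelL.idl_le (mem_map_C_iff.2 h1) fun i => mem_map_C_iff.2 (h2 i (Finset.mem_univ _))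
    rw [hu] at h3
    have := mem_map_C_iff.1 (h3 (Submodule.mem_top (x := 1))) 0
    rw [← map_one LaurentPolynomial.C, C_apply, if_pos rfl] at this
    exact hq.ne_top ((Ideal.eq_top_iff_one _).2 this)

end Core



section Core2
open LaurentPolynomial
variable {Q : Type*} [CommRing Q]

theorem invert_coeff (b : Q[T;T⁻¹]) (n : ℤ) : (invert b).coeff n = b.coeff (-n) := by
  simp

theorem laurent_core {d : ℕ} (hd1 : 1 ≤ d) (hd : ringKrullDim Q ≤ d) {τ : Q} (hτ : τ ∈ nonZeroDivisors Q)
    {a : Q[T;T⁻¹]} {f : Fin (d + 1) → Q[T;T⁻¹]} (ha : LaurentPolynomial.C τ ∣ a - 1)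
    (hu : RelL.idl a f = ⊤) : RelL (LaurentPolynomial.C τ) a f 1 0 := by
  classical
  rcases subsingleton_or_nontrivial Q with hQ | hQ
  · haveI : Subsingleton Q[T;T⁻¹] := ⟨fun x y => by ext n; exact Subsingleton.elim _ _⟩
    exact RelL.refl' (Subsingleton.elim _ _) (Subsingleton.elim _ _)
  obtain ⟨φ, hprim⟩ := prim_step ha hu
  have R1 : RelL (LaurentPolynomial.C τ) a f (a + LaurentPolynomial.C τ * (φ ⬝ᵥ f)) f := RelL.op1 φ
  refine R1.trans ?_
  have ha1 := R1.dvd ha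
  have hu1 := R1.idl_eq.trans hu
  clear R1 ha hu
  revert ha1 hu1 hprim
  generalize a + LaurentPolynomial.C τ * (φ ⬝ᵥ f) = b
  intro hprim hb hu
  set h := f (Fin.last d) with hh
  obtain ⟨x, hx⟩ := strat hd hprim (b.coeff.support.toList.map b.coeff) ⊥ 1 (h := h)
    (fun i => f i.castSucc) (by
      have h1 : (1 : Q[T;T⁻¹]) ∈ RelL.idl b f := by rw [hu]; trivial
      refine (RelL.idl_le ?_ ?_ : RelL.idl b f ≤ _) h1
      · exact Ideal.mem_sup_left (Ideal.mem_sup_left (Ideal.mem_span_singleton_self b))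
      · intro i
        induction i using Fin.lastCases with
        | last => exact Ideal.mem_sup_right (Ideal.mem_span_singleton_self _)
        | cast i => exact Ideal.mem_sup_left (Ideal.mem_sup_right (Ideal.subset_span ⟨i, rfl⟩)))
  have R2 := RelL.tv (f := f) hb (Fin.snoc x 0 : Fin (d + 1) → Q[T;T⁻¹]) (Pi.single (Fin.last d) 1)
    (by rw [single_dotProduct, Fin.snoc_last, mul_zero])
  refine R2.trans ?_
  have hu2 := R2.idl_eq.trans hu
  rw [single_dotProduct, one_mul, ← hh] at hu2 ⊢
  set f1 : Fin (d + 1) → Q[T;T⁻¹] := f + h • (Fin.snoc x 0 : Fin (d + 1) → Q[T;T⁻¹]) with hf1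
  have hlast : f1 (Fin.last d) = h := by
    rw [hf1, Pi.add_apply, Pi.smul_apply, Fin.snoc_last, smul_zero, add_zero]
  set J := Ideal.span {b} ⊔ Ideal.span (Set.range fun i : Fin d =>
      f i.castSucc + (LaurentPolynomial.C 1 * h) * x i) with hJ
  have hJle : J ≤ Ideal.span {b} ⊔ Ideal.span (f1 '' {Fin.last d}ᶜ) := by
    refine sup_le_sup_left (Ideal.span_mono ?_) _
    rintro _ ⟨i, rfl⟩
    refine ⟨i.castSucc, by simp [(Fin.castSucc_lt_last i).ne], ?_⟩
    rw [hf1, Pi.add_apply, Pi.smul_apply, Fin.snoc_castSucc, map_one, one_mul, smul_eq_mul]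
  have hbJ : b ∈ J := Ideal.mem_sup_left (Ideal.mem_span_singleton_self b)
  have hG : ∀ 𝔓 : Ideal Q[T;T⁻¹], 𝔓.IsPrime → J ≤ 𝔓 → ∀ m : Ideal Q, m ≠ ⊤ →
      𝔓.comap (LaurentPolynomial.C : Q →+* Q[T;T⁻¹]) ≤ m → ∀ k, b.coeff k ∈ m →
      LaurentPolynomial.C (b.coeff k) ∈ 𝔓 := by
    intro 𝔓 h𝔓 hJ𝔓 m hm hle k hk
    have h1 := (hx.extract h𝔓 hJ𝔓 hm hle bot_le
      (fun h => h𝔓.ne_top ((Ideal.eq_top_iff_one _).2 (by simpa using h)))).2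
    by_cases h0 : b.coeff k = 0
    · rw [h0, map_zero]; exact 𝔓.zero_mem
    · exact h1 _ (List.mem_map.2 ⟨k, by simpa using h0, rfl⟩) hk
  obtain ⟨p, hpJ, hp0⟩ := comonic hbJ hprim hG
  obtain ⟨q, hqJ, hq0⟩ := comonic (J := J.comap (invert : Q[T;T⁻¹] ≃ₐ[Q] Q[T;T⁻¹])) (v := invert b)
    (by rw [Ideal.mem_comap, involutive_invert b]; exact hbJ)
    (fun q hq => by
      obtain ⟨k, hk⟩ := hprim q hq
      exact ⟨-k, by rwa [invert_coeff, neg_neg]⟩)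
    (fun 𝔓 h𝔓 hle m hm hqm k hk => by
      rw [invert_coeff] at hk ⊢
      have := hG (𝔓.comap (invert : Q[T;T⁻¹] ≃ₐ[Q] Q[T;T⁻¹])) (h𝔓.comap _) (by
        intro z hz
        refine hle ?_
        rw [Ideal.mem_comap, involutive_invert z]; exact hz) m hm (by
        intro z hz
        apply hqm
        rw [Ideal.mem_comap, Ideal.mem_comap] at hz
        have e : invert (LaurentPolynomial.C z : Q[T;T⁻¹]) = LaurentPolynomial.C z := invert_C z
        rw [Ideal.mem_comap, ← e]; exact hz) (-k) hk
      rw [Ideal.mem_comap] at this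
      have e : invert (LaurentPolynomial.C (b.coeff (-k)) : Q[T;T⁻¹]) = LaurentPolynomial.C _ := invert_C _
      rw [← e]; exact this)
  have hq'J : toLaurent q.reverse ∈ J := by
    rw [toLaurent_reverse]
    exact Ideal.mul_mem_right _ _ hqJ
  have hq'm : q.reverse.Monic := by
    rw [Polynomial.Monic, Polynomial.reverse_leadingCoeff, Polynomial.trailingCoeff,
      Polynomial.natTrailingDegree_eq_zero_of_constantCoeff_ne_zero, hq0]
    simp [hq0]
  obtain ⟨n, F, hF⟩ := h.exists_T_pow
  set L := (p + X * F).natDegree + 1 with hL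
  set z : Q[T;T⁻¹] := T (-1 - n) * (toLaurent p + T L * toLaurent q.reverse) with hz
  have R3 := RelL.add_single (f := f1) hb (Fin.last d) z (hJle (by
    exact Ideal.mul_mem_left _ _ (add_mem hpJ (Ideal.mul_mem_left _ _ hq'J))))
  refine R3.trans ?_
  have hne : (⟨0, by omega⟩ : Fin (d + 1)) ≠ Fin.last d := by
    intro h; have := congrArg Fin.val h; simp at this; omega
  refine laurent_core_monic hτ hne hb (R3.idl_eq.trans hu2) (g := p + X * F + X ^ L * q.reverse)
    (N := -1 - n) ?_ ?_ ?_
  · refine Polynomial.Monic.add_of_right ((monic_X_pow L).mul hq'm) ?_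
    refine lt_of_le_of_lt Polynomial.degree_le_natDegree ?_
    rw [Polynomial.degree_eq_natDegree ((monic_X_pow L).mul hq'm).ne_zero,
      (monic_X_pow L).natDegree_mul hq'm, natDegree_X_pow]
    exact_mod_cast (by omega)
  · rw [hL, pow_succ]
    simp [hp0, Polynomial.mul_coeff_zero]
  · rw [Function.update_self, hlast, hz, map_add, map_add, map_mul, map_mul, toLaurent_X_pow, toLaurent_X, hF]
    have e : (T (-1 - n) * T 1 * T n : Q[T;T⁻¹]) = 1 := by
      rw [← T_add, ← T_add]; convert T_zero using 2; ring
    linear_combination - h * e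

end Core2



section E2sec
variable {B : Type*} [CommRing B]

inductive E2 (I : Ideal B) : B → B → Prop
  | base {a b : B} (h1 : a - 1 ∈ I) (h2 : b ∈ I) : E2 I a b
  | s1 {a b : B} (x : B) : E2 I (a + x * b) b → E2 I a b
  | s2 {a b : B} (x : B) : E2 I a (b + x * a) → E2 I a b

namespace E2
variable {I : Ideal B}

theorem congr {a b : B} (h : E2 I a b) : ∀ {a' b' : B}, a - a' ∈ I → b - b' ∈ I → E2 I a' b' := by
  induction h with
  | @base a b h1 h2 =>
    intro a' b' ha hb
    refine base ?_ ?_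
    · have := sub_mem h1 ha; convert this using 1; ring
    · have := sub_mem h2 hb; convert this using 1; ring
  | @s1 a b x h ih =>
    intro a' b' ha hb
    refine s1 x (ih ?_ hb)
    have := add_mem ha (I.mul_mem_left x hb); convert this using 1; ring
  | @s2 a b x h ih =>
    intro a' b' ha hb
    refine s2 x (ih ha ?_)
    have := add_mem hb (I.mul_mem_left x ha); convert this using 1; ring

theorem neg {a b : B} (h : E2 I a b) : E2 I a (-b) := by
  induction h with
  | base h1 h2 => exact base h1 (I.neg_mem h2)
  | @s1 a b x h ih => exact s1 (-x) (by convert ih using 1; ring)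
  | @s2 a b x h ih => exact s2 (-x) (by convert ih using 1; ring)

theorem swap {a b : B} (h : E2 I a b) : E2 I b a := by
  refine s1 1 (s2 (-1) (s1 1 ?_))
  convert h.neg using 1 <;> ring

theorem of_unit {a b u : B} (h : a * u - 1 ∈ I) : E2 I a b := by
  refine (s2 (u * (1 - b)) (?_ : E2 I a _))
  refine E2.congr (a := a) (b := 1) (s1 (1 - a) (s2 (-1) (base ?_ ?_))) ?_ ?_
  · convert I.zero_mem using 1; ring
  · convert I.zero_mem using 1; ring
  · simp
  · have := I.mul_mem_left (-(1 - b)) h; convert this using 1; ring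

theorem nil {a b c : B} {N : ℕ} (hc : c ^ N ∈ I) (h : E2 (I ⊔ Ideal.span {c}) a b) : E2 I a b := by
  induction h with
  | @base a b h1 h2 =>
    obtain ⟨y, hy, w, hw, hyw⟩ := Submodule.mem_sup.1 h1
    obtain ⟨z, rfl⟩ := Ideal.mem_span_singleton'.1 hw
    have h3 : (1 - a) ^ N ∈ I := by
      have h4 : (1 - a) ^ N - (- z * c) ^ N ∈ I := by
        refine Ideal.mem_of_dvd _ (sub_dvd_pow_sub_pow _ _ _) ?_
        have := I.neg_mem hy; convert this using 1; linear_combination hyw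
      have h5 : (- z * c) ^ N ∈ I := by rw [mul_pow]; exact I.mul_mem_left _ hc
      have := add_mem h4 h5; simpa using this
    have h6 : a ∣ 1 - (1 - a) ^ N := by
      have := sub_dvd_pow_sub_pow 1 (1 - a) N
      rwa [one_pow, sub_sub_cancel] at this
    obtain ⟨u, hu⟩ := h6
    refine of_unit (u := u) ?_
    have := I.neg_mem h3; convert this using 1; linear_combination -hu
  | s1 x _ ih => exact s1 x ih
  | s2 x _ ih => exact s2 x ih

theorem glue1 {e a b : B} (h : E2 (I ⊔ Ideal.span {e}) a b) : ∀ {a0 b0 : B},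
    a0 - a ∈ I ⊔ Ideal.span {e} → b0 - b ∈ I ⊔ Ideal.span {e} →
    (∀ a' b' : B, a' - 1 ∈ I ⊔ Ideal.span {e} → b' ∈ I ⊔ Ideal.span {e} →
      a' - a0 ∈ I ⊔ Ideal.span {1 - e} → b' - b0 ∈ I ⊔ Ideal.span {1 - e} → E2 I a' b') → E2 I a0 b0 := by
  have he : e ∈ I ⊔ Ideal.span {e} := Ideal.mem_sup_right (Ideal.mem_span_singleton_self e)
  have he' : 1 - e ∈ I ⊔ Ideal.span {1 - e} := Ideal.mem_sup_right (Ideal.mem_span_singleton_self _)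
  induction h with
  | @base a b h1 h2 =>
    intro a0 b0 ha hb H
    refine H a0 b0 ?_ ?_ (by simp) (by simp)
    · convert add_mem ha h1 using 1; ring
    · convert add_mem hb h2 using 1; ring
  | @s1 a b x h ih =>
    intro a0 b0 ha hb H
    refine s1 (x * (1 - e)) (ih ?_ hb ?_)
    · convert add_mem (add_mem ha (Ideal.mul_mem_left _ x hb)) (Ideal.mul_mem_left _ (- x * b0) he) using 1
      ring
    · intro a' b' h1 h2 h3 h4
      refine H a' b' h1 h2 ?_ h4
      convert add_mem h3 (Ideal.mul_mem_left _ (x * b0) he') using 1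
      ring
  | @s2 a b x h ih =>
    intro a0 b0 ha hb H
    refine s2 (x * (1 - e)) (ih ha ?_ ?_)
    · convert add_mem (add_mem hb (Ideal.mul_mem_left _ x ha)) (Ideal.mul_mem_left _ (- x * a0) he) using 1
      ring
    · intro a' b' h1 h2 h3 h4
      refine H a' b' h1 h2 h3 ?_
      convert add_mem h4 (Ideal.mul_mem_left _ (x * a0) he') using 1
      ring

theorem glue {e a b : B} (hee : e * (1 - e) ∈ I) (h : E2 (I ⊔ Ideal.span {e}) a b)
    (h' : E2 (I ⊔ Ideal.span {1 - e}) a b) : E2 I a b := by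
  have hintg : ∀ x, x ∈ I ⊔ Ideal.span {e} → x ∈ I ⊔ Ideal.span {1 - e} → x ∈ I := by
    intro x h1 h2
    obtain ⟨y, hy, w, hw, hyw⟩ := Submodule.mem_sup.1 h1
    obtain ⟨z, rfl⟩ := Ideal.mem_span_singleton'.1 hw
    obtain ⟨y', hy', w', hw', hyw'⟩ := Submodule.mem_sup.1 h2
    obtain ⟨z', rfl⟩ := Ideal.mem_span_singleton'.1 hw'
    have : x = (1 - e) * y + z * (e * (1 - e)) + (e * y' + z' * (e * (1 - e))) := by
      linear_combination - (1 - e) * hyw - e * hyw'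
    rw [this]
    exact add_mem (add_mem (I.mul_mem_left _ hy) (I.mul_mem_left _ hee))
      (add_mem (I.mul_mem_left _ hy') (I.mul_mem_left _ hee))
  refine glue1 h (by simp) (by simp) fun a' b' h1 h2 h3 h4 => ?_
  refine glue1 (h'.congr (a' := a') (b' := b') (by simpa using neg_mem h3) (by simpa using neg_mem h4))
    (by simp) (by simp) fun a'' b'' k1 k2 k3 k4 => ?_
  rw [sub_sub_cancel] at k3 k4
  refine base (hintg _ ?_ k1) (hintg _ ?_ k2)
  · convert add_mem k3 h1 using 1; ring
  · convert add_mem k4 h2 using 1; ring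

end E2
end E2sec

section Zero
open LaurentPolynomial
variable {Q : Type*} [CommRing Q]

theorem zero_dim (hd : ringKrullDim Q ≤ 0) (x : Q) : ∃ (N : ℕ) (z : Q), x ^ N * (1 + x * z) = 0 := by
  by_contra hcon
  have hdis : Disjoint ((⊥ : Ideal Q) : Set Q) (strMonoid x) := by
    rw [Set.disjoint_left]
    rintro _ h0 ⟨k, y, rfl⟩
    exact hcon ⟨k, y, h0⟩
  obtain ⟨p, hp, -, hpd⟩ := Ideal.exists_le_prime_disjoint _ _ hdis
  rw [Set.disjoint_left] at hpd
  haveI : Ring.KrullDimLE 0 Q := by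
    rw [Ring.krullDimLE_iff]; simpa using hd
  have hm : p.IsMaximal := inferInstance
  have hx : x ∉ p := fun h => hpd h ⟨1, 0, by simp⟩
  obtain ⟨y, i, hi, hy⟩ := hm.exists_inv hx
  refine hpd hi ⟨0, -y, ?_⟩
  linear_combination hy

theorem E2_laurent (hz : ∀ x : Q, ∃ (N : ℕ) (z : Q), x ^ N * (1 + x * z) = 0) : ∀ (n : ℕ) (J : Ideal Q) (i j : ℤ) (F G : Q[X]) (nF nG : ℕ),
    nF + nG ≤ n → F.degree < nF → G.degree < nG →
    1 ∈ Ideal.span {T i * toLaurent F} ⊔ Ideal.span {T j * toLaurent G} ⊔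
      J.map (LaurentPolynomial.C : Q →+* Q[T;T⁻¹]) →
    E2 (J.map (LaurentPolynomial.C : Q →+* Q[T;T⁻¹])) (T i * toLaurent F) (T j * toLaurent G) := by
  intro n
  induction n with
  | zero =>
    intro J i j F G nF nG hn hF hG hu
    have hF0 : F = 0 := by
      have : nF = 0 := by omega
      subst this; exact Polynomial.degree_eq_bot.1 (by simpa [Nat.WithBot.lt_zero_iff] using hF)
    have hG0 : G = 0 := by
      have : nG = 0 := by omega
      subst this; exact Polynomial.degree_eq_bot.1 (by simpa [Nat.WithBot.lt_zero_iff] using hG)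
    rw [hF0, hG0] at hu ⊢
    simp only [map_zero, mul_zero, Ideal.span_singleton_eq_bot.2, bot_sup_eq] at hu ⊢
    refine E2.of_unit (u := 0) ?_
    have := neg_mem hu; simpa using this
  | succ n ih =>
    have main : ∀ (J : Ideal Q) (i j : ℤ) (F G : Q[X]) (nF nG : ℕ), nG ≤ nF →
        nF + nG ≤ n + 1 → F.degree < nF → G.degree < nG →
        1 ∈ Ideal.span {T i * toLaurent F} ⊔ Ideal.span {T j * toLaurent G} ⊔
          J.map (LaurentPolynomial.C : Q →+* Q[T;T⁻¹]) →
        E2 (J.map (LaurentPolynomial.C : Q →+* Q[T;T⁻¹])) (T i * toLaurent F) (T j * toLaurent G) := by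
      intro J i j F G nF nG hle hn hF hG hu
      rcases Nat.eq_zero_or_pos nG with h0 | hpos
      · have hG0 : G = 0 := by
          subst h0; exact Polynomial.degree_eq_bot.1 (by simpa [Nat.WithBot.lt_zero_iff] using hG)
        rw [hG0] at hu ⊢
        simp only [map_zero, mul_zero, Ideal.span_singleton_eq_bot.2, sup_bot_eq] at hu ⊢
        obtain ⟨y, hy, w, hw, hyw⟩ := Submodule.mem_sup.1 hu
        obtain ⟨z, rfl⟩ := Ideal.mem_span_singleton'.1 hy
        refine E2.of_unit (u := z) ?_
        have := neg_mem hw; convert this using 1; linear_combination hyw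
      -- truncation
      have trunc : ∀ (H : Q[X]) (k : ℕ), H.degree < ((k + 1 : ℕ) : WithBot ℕ) →
          (H - Polynomial.C (H.coeff k) * X ^ k).degree < (k : WithBot ℕ) := by
        intro H k hH
        rw [Polynomial.degree_lt_iff_coeff_zero] at hH ⊢
        intro l hl
        rw [Polynomial.coeff_sub, Polynomial.coeff_C_mul, Polynomial.coeff_X_pow]
        by_cases hlk : l = k
        · subst hlk; simp
        · rw [if_neg hlk, hH l (by omega)]; simp
      have mapsup : ∀ (J : Ideal Q) (x : Q), (J ⊔ Ideal.span {x}).map (LaurentPolynomial.C : Q →+* Q[T;T⁻¹]) =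
          J.map LaurentPolynomial.C ⊔ Ideal.span {LaurentPolynomial.C x} := by
        intro J x
        rw [Ideal.map_sup, Ideal.map_span, Set.image_singleton]
      -- congruence of unimodularity
      have ucongr : ∀ (K : Ideal Q[T;T⁻¹]) (a b a' b' : Q[T;T⁻¹]), a ∈ Ideal.span {a'} ⊔ Ideal.span {b'} ⊔ K →
          b ∈ Ideal.span {a'} ⊔ Ideal.span {b'} ⊔ K → J.map LaurentPolynomial.C ≤ K →
          1 ∈ Ideal.span {a} ⊔ Ideal.span {b} ⊔ J.map LaurentPolynomial.C →
          1 ∈ Ideal.span {a'} ⊔ Ideal.span {b'} ⊔ K := by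
        intro K a b a' b' h1 h2 h3 h4
        refine (sup_le (sup_le ?_ ?_) ?_ : Ideal.span {a} ⊔ Ideal.span {b} ⊔ J.map LaurentPolynomial.C ≤ _) h4
        · rwa [Ideal.span_singleton_le_iff_mem]
        · rwa [Ideal.span_singleton_le_iff_mem]
        · exact h3.trans le_sup_right
      obtain ⟨g, rfl⟩ : ∃ g, nG = g + 1 := ⟨nG - 1, by omega⟩
      obtain ⟨k, rfl⟩ : ∃ k, nF = k + 1 := ⟨nF - 1, by omega⟩
      set c := G.coeff g with hc
      obtain ⟨N, z, hNz⟩ : ∃ (N : ℕ) (z : Q), c ^ (N + 1) * (1 - c * z) = 0 := by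
        obtain ⟨N, z, h⟩ := hz c
        exact ⟨N, -z, by rw [pow_succ]; linear_combination c * h⟩
      have hpw : c ^ (N + 1) * (1 - (c * z) ^ (N + 1)) = 0 := by
        obtain ⟨w, hw⟩ : (1 - c * z) ∣ 1 - (c * z) ^ (N + 1) := by
          have := sub_dvd_pow_sub_pow 1 (c * z) (N + 1)
          rwa [one_pow] at this
        rw [hw, ← mul_assoc, hNz, zero_mul]
      set e := (c * z) ^ (N + 1) with he
      have hee : e * (1 - e) = 0 := by
        have : e = z ^ (N + 1) * c ^ (N + 1) := by rw [he, mul_pow, mul_comm]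
        nth_rewrite 1 [this]
        rw [mul_assoc, hpw, mul_zero]
      have hcu : c * (z * (c * z) ^ N) = e := by rw [he, pow_succ]; ring
      refine E2.glue (e := LaurentPolynomial.C e) ?_ ?_ ?_
      · rw [← map_one LaurentPolynomial.C, ← map_sub, ← map_mul, hee, map_zero]; exact zero_mem _
      · -- c nilpotent
        rw [← mapsup]
        refine E2.nil (c := LaurentPolynomial.C c) (N := N + 1) ?_ ?_
        · rw [← map_pow]
          refine Ideal.mem_map_of_mem _ (Ideal.mem_sup_right (Ideal.mem_span_singleton'.2 ⟨c ^ (N + 1), ?_⟩))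
          linear_combination - hpw
        · rw [← mapsup]
          set J' := J ⊔ Ideal.span {e} ⊔ Ideal.span {c} with hJ'
          have hcJ : (LaurentPolynomial.C c : Q[T;T⁻¹]) ∈ J'.map LaurentPolynomial.C :=
            Ideal.mem_map_of_mem _ (Ideal.mem_sup_right (Ideal.mem_span_singleton_self c))
          have hdiff : T j * toLaurent (G - Polynomial.C c * X ^ g) - T j * toLaurent G ∈
              J'.map (LaurentPolynomial.C : Q →+* Q[T;T⁻¹]) := by
            rw [map_sub, map_mul, toLaurent_C]
            convert Ideal.mul_mem_left _ (- T j * toLaurent (X ^ g)) hcJ using 1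
            ring
          refine E2.congr (ih J' i j F (G - Polynomial.C c * X ^ g) (k + 1) g (by omega) hF
            (trunc G g hG) ?_) (by simp) hdiff
          refine ucongr _ _ _ _ _ ?_ ?_ (Ideal.map_mono (le_sup_left.trans le_sup_left)) hu
          · exact Ideal.mem_sup_left (Ideal.mem_sup_left (Ideal.mem_span_singleton_self _))
          · have h1 := Ideal.mem_sup_left (T := J'.map (LaurentPolynomial.C : Q →+* Q[T;T⁻¹]))
              (Ideal.mem_sup_right (S := Ideal.span {T i * toLaurent F})
              (Ideal.mem_span_singleton_self (T j * toLaurent (G - Polynomial.C c * X ^ g))))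
            have := sub_mem h1 (Ideal.mem_sup_right hdiff)
            rwa [sub_sub_cancel] at this
      · -- c a unit
        rw [← map_one LaurentPolynomial.C, ← map_sub, ← mapsup]
        set J' := J ⊔ Ideal.span {1 - e} with hJ'
        set u := z * (c * z) ^ N with hu'
        obtain ⟨s, hs⟩ : ∃ s, s = F.coeff k * u := ⟨_, rfl⟩
        have heJ : (LaurentPolynomial.C (1 - e) : Q[T;T⁻¹]) ∈ J'.map LaurentPolynomial.C :=
            Ideal.mem_map_of_mem _ (Ideal.mem_sup_right (Ideal.mem_span_singleton_self _))
        set H := F - Polynomial.C s * X ^ (k - g) * G with hH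
        have hHk : H.coeff k = F.coeff k * (1 - e) := by
          rw [hH, Polynomial.coeff_sub, mul_assoc, Polynomial.coeff_C_mul, Polynomial.coeff_X_pow_mul', if_pos (by omega),
            show k - (k - g) = g by omega, ← hc, hs]
          linear_combination - F.coeff k * hcu
        have hHd : H.degree < ((k + 1 : ℕ) : WithBot ℕ) := by
          rw [Polynomial.degree_lt_iff_coeff_zero] at hF hG ⊢
          intro l hl
          rw [hH, Polynomial.coeff_sub, mul_assoc, Polynomial.coeff_C_mul, Polynomial.coeff_X_pow_mul', if_pos (by omega), hF l hl,
            hG _ (by omega)]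
          simp
        refine E2.s1 (- (T (i - j + (k - g : ℕ)) * LaurentPolynomial.C s)) ?_
        have e1 : T i * toLaurent F + - (T (i - j + (k - g : ℕ)) * LaurentPolynomial.C s) * (T j * toLaurent G)
            = T i * toLaurent H := by
          rw [hH, map_sub, map_mul, map_mul, toLaurent_C, toLaurent_X_pow]
          have : (T (i - j + (k - g : ℕ)) * T j : Q[T;T⁻¹]) = T i * T (k - g : ℕ) := by
            rw [← T_add, ← T_add]; congr 1; ring
          linear_combination (- LaurentPolynomial.C s * toLaurent G) * this
        rw [e1]
        have hdiff : T i * toLaurent (H - Polynomial.C (H.coeff k) * X ^ k) - T i * toLaurent H ∈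
              J'.map (LaurentPolynomial.C : Q →+* Q[T;T⁻¹]) := by
            rw [map_sub, map_mul, toLaurent_C, hHk, map_mul LaurentPolynomial.C]
            convert Ideal.mul_mem_left _ (- T i * toLaurent (X ^ k) * LaurentPolynomial.C (F.coeff k)) heJ using 1
            ring
        refine E2.congr (ih J' i j (H - Polynomial.C (H.coeff k) * X ^ k) G k (g + 1) (by omega) (trunc H k hHd) hG ?_)
          hdiff (by simp)
        have hb : T j * toLaurent G ∈ Ideal.span {T i * toLaurent (H - Polynomial.C (H.coeff k) * X ^ k)} ⊔
            Ideal.span {T j * toLaurent G} ⊔ J'.map (LaurentPolynomial.C : Q →+* Q[T;T⁻¹]) :=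
          Ideal.mem_sup_left (Ideal.mem_sup_right (Ideal.mem_span_singleton_self _))
        refine ucongr _ _ _ _ _ ?_ hb (Ideal.map_mono le_sup_left) hu
        have h1 := Ideal.mem_sup_left (T := J'.map (LaurentPolynomial.C : Q →+* Q[T;T⁻¹]))
              (Ideal.mem_sup_left (T := Ideal.span {T j * toLaurent G})
              (Ideal.mem_span_singleton_self (T i * toLaurent (H - Polynomial.C (H.coeff k) * X ^ k))))
        have h2 := sub_mem h1 (Ideal.mem_sup_right hdiff)
        rw [sub_sub_cancel, ← e1] at h2
        have h3 := add_mem h2 (Ideal.mul_mem_left _ (T (i - j + (k - g : ℕ)) * LaurentPolynomial.C s) hb)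
        convert h3 using 1; ring
    intro J i j F G nF nG hn hF hG hu
    rcases le_total nG nF with h | h
    · exact main J i j F G nF nG h hn hF hG hu
    · refine (main J j i G F nG nF h (by omega) hG hF ?_).swap
      rwa [sup_comm (Ideal.span {T j * toLaurent G})]

theorem E2.toRelL {B : Type*} [CommRing B] {τ σ : B} (hτ : τ * σ = 1) {a b : B} (h : E2 (⊥ : Ideal B) a b) :
    RelL τ a (fun _ : Fin 1 => b) 1 0 := by
  induction h with
  | base h1 h2 =>
    refine RelL.refl' (sub_eq_zero.1 h1) ?_
    funext i; exact h2
  | @s1 a b x h ih =>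
    refine RelL.s1 (fun _ => σ * x) ?_
    convert ih using 1
    simp only [dotProduct, Finset.univ_unique, Finset.sum_const, Finset.card_singleton, one_smul]
    linear_combination x * b * hτ
  | @s2 a b x h ih =>
    refine RelL.s2 (fun _ => x) ?_
    convert ih using 1
    funext i; simp [mul_comm]

theorem laurent_core_zero (hd : ringKrullDim Q ≤ 0) {τ : Q} (hτ : τ ∈ nonZeroDivisors Q)
    {a : Q[T;T⁻¹]} {f : Fin 1 → Q[T;T⁻¹]} 
    (hu : RelL.idl a f = ⊤) : RelL (LaurentPolynomial.C τ) a f 1 0 := by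
  have hz := zero_dim hd
  obtain ⟨σ, hσ⟩ : ∃ σ, τ * σ = 1 := by
    obtain ⟨N, z, h⟩ := hz τ
    refine ⟨-z, ?_⟩
    have := (mul_left_mem_nonZeroDivisors_eq_zero_iff (pow_mem hτ N)).1 h
    linear_combination -this
  have hf : f = fun _ => f 0 := by funext i; rw [Subsingleton.elim i 0]
  rw [hf]
  refine E2.toRelL (σ := LaurentPolynomial.C σ) (by rw [← map_mul, hσ, map_one]) ?_
  obtain ⟨n, F, hF⟩ := a.exists_T_pow
  obtain ⟨m, G, hG⟩ := (f 0).exists_T_pow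
  have ea : T (-n) * toLaurent F = a := by
    rw [hF, mul_comm, mul_assoc, ← T_add]; simp
  have eb : T (-m) * toLaurent G = f 0 := by
    rw [hG, mul_comm, mul_assoc, ← T_add]; simp
  have := E2_laurent hz _ ⊥ (-n) (-m) F G (F.natDegree + 1) (G.natDegree + 1) le_rfl
    (lt_of_le_of_lt Polynomial.degree_le_natDegree (by exact_mod_cast Nat.lt_succ_self _))
    (lt_of_le_of_lt Polynomial.degree_le_natDegree (by exact_mod_cast Nat.lt_succ_self _))
  rw [ea, eb, Ideal.map_bot, sup_bot_eq] at this
  apply this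
  have h1 : (1 : Q[T;T⁻¹]) ∈ RelL.idl a f := by rw [hu]; trivial
  refine (RelL.idl_le ?_ ?_ : RelL.idl a f ≤ _) h1
  · exact Ideal.mem_sup_left (Ideal.mem_span_singleton_self _)
  · intro i; rw [hf]; exact Ideal.mem_sup_right (Ideal.mem_span_singleton_self _)

/-- uniform version of the core statement -/
theorem core_all {r : ℕ} (hr : 1 ≤ r) (hd : ringKrullDim Q < r) {τ : Q} (hτ : τ ∈ nonZeroDivisors Q)
    {a : Q[T;T⁻¹]} {f : Fin r → Q[T;T⁻¹]} (ha : LaurentPolynomial.C τ ∣ a - 1)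
    (hu : RelL.idl a f = ⊤) : RelL (LaurentPolynomial.C τ) a f 1 0 := by
  obtain ⟨d, rfl⟩ : ∃ d, r = d + 1 := ⟨r - 1, by omega⟩
  have hd' : ringKrullDim Q ≤ d := ENat.WithBot.lt_add_one_iff.1 (by simpa using hd)
  rcases Nat.eq_zero_or_pos d with rfl | hpos
  · exact laurent_core_zero (by simpa using hd') hτ hu
  · exact laurent_core hpos hd' hτ ha hu

end Zero



section RedSec
variable {A : Type*} [CommRing A] {P : Type*} [AddCommGroup P] [Module A P]

inductive Red (K : Ideal A) : A → P → Prop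
  | base {a : A} {p : P} (h1 : a - 1 ∈ K) (h2 : p ∈ (K • ⊤ : Submodule A P)) : Red K a p
  | add1 {a : A} {p : P} (φ : P →ₗ[A] A) : Red K (a + φ p) p → Red K a p
  | add2 {a : A} {p : P} (q : P) : Red K a (p + a • q) → Red K a p

theorem map_smul_top {K : Ideal A} {M : Type*} [AddCommGroup M] [Module A M] (φ : P →ₗ[A] M) {p : P}
    (h : p ∈ (K • ⊤ : Submodule A P)) : φ p ∈ (K • ⊤ : Submodule A M) := by
  have h1 : (K • ⊤ : Submodule A P).map φ ≤ (K • ⊤ : Submodule A M) := by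
    rw [Submodule.map_smul'']
    exact Submodule.smul_mono le_rfl le_top
  exact h1 ⟨p, h, rfl⟩

theorem map_smul_top' {K : Ideal A} (φ : P →ₗ[A] A) {p : P}
    (h : p ∈ (K • ⊤ : Submodule A P)) : φ p ∈ K := by
  have := map_smul_top φ h
  rwa [smul_eq_mul, Ideal.mul_top] at this

namespace Red
variable {K : Ideal A}

theorem congr {a : A} {p : P} (h : Red K a p) : ∀ {a' : A} {p' : P}, a - a' ∈ K →
    p - p' ∈ (K • ⊤ : Submodule A P) → Red K a' p' := by
  induction h with
  | @base a p h1 h2 =>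
    intro a' p' ha hp
    refine base ?_ ?_
    · have := sub_mem h1 ha; convert this using 1; ring
    · have := sub_mem h2 hp; convert this using 1; abel
  | @add1 a p φ h ih =>
    intro a' p' ha hp
    refine add1 φ (ih ?_ hp)
    have := add_mem ha (map_smul_top' φ hp); rw [map_sub] at this; convert this using 1; ring
  | @add2 a p q h ih =>
    intro a' p' ha hp
    refine add2 q (ih ha ?_)
    have := add_mem hp (Submodule.smul_mem_smul ha (Submodule.mem_top (x := q)))
    rw [sub_smul] at this; convert this using 1; abel

theorem transport {a : A} {p : P} (S S' : P →ₗ[A] P) (h : ∀ p, S (S' p) - p ∈ (K • ⊤ : Submodule A P))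
    (hr : Red K a p) : Red K a (S' p) := by
  induction hr with
  | base h1 h2 => exact base h1 (map_smul_top S' h2)
  | @add1 a p φ _ ih =>
    refine add1 (φ.comp S) (ih.congr ?_ (by simp))
    have := K.neg_mem (map_smul_top' φ (h p)); rw [map_sub] at this
    rw [LinearMap.comp_apply]; convert this using 1; ring
  | @add2 a p q _ ih =>
    refine add2 (S' q) ?_
    rwa [map_add, map_smul] at ih

theorem transport' {a : A} {p : P} (S S' : P →ₗ[A] P) (h : ∀ p, S (S' p) - p ∈ (K • ⊤ : Submodule A P))
    (h' : ∀ p, S' (S p) - p ∈ (K • ⊤ : Submodule A P))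
    (hr : Red K a (S p)) : Red K a p :=
  (hr.transport S S' h).congr (by simp) (h' p)

def Um (K : Ideal A) (a : A) (p : P) : Prop := ∃ (x : A) (ψ : P →ₗ[A] A), x * a + ψ p - 1 ∈ K

theorem lift {K' : Ideal A} {a : A} {p : P} (h : Red K' a p) (hu : Um K a p) :
    ∃ (a' : A) (p' : P), a' - 1 ∈ K' ∧ p' ∈ (K' • ⊤ : Submodule A P) ∧ Um K a' p' ∧
      (Red K a' p' → Red K a p) := by
  induction h with
  | @base a p h1 h2 => exact ⟨a, p, h1, h2, hu, id⟩
  | @add1 a p φ _ ih =>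
    obtain ⟨x, ψ, hx⟩ := hu
    obtain ⟨a', p', h1, h2, h3, h4⟩ := ih ⟨x, ψ - x • φ, by
      convert hx using 1
      rw [LinearMap.sub_apply, LinearMap.smul_apply, smul_eq_mul]; ring⟩
    exact ⟨a', p', h1, h2, h3, fun h => add1 φ (h4 h)⟩
  | @add2 a p q _ ih =>
    obtain ⟨x, ψ, hx⟩ := hu
    obtain ⟨a', p', h1, h2, h3, h4⟩ := ih ⟨x - ψ q, ψ, by
      convert hx using 1
      rw [map_add, map_smul, smul_eq_mul]; ring⟩
    exact ⟨a', p', h1, h2, h3, fun h => add2 q (h4 h)⟩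

end Red

noncomputable def tvEquiv {M : Type*} [AddCommGroup M] [Module A M] (x : M) (φ : M →ₗ[A] A) (h : φ x = 0) : M ≃ₗ[A] M :=
  LinearEquiv.ofLinearMap (LinearMap.id + φ.smulRight x) (LinearMap.id - φ.smulRight x)
    (by ext q; simp [h]) (by ext q; simp [h])

theorem tvEquiv_apply {M : Type*} [AddCommGroup M] [Module A M] (x : M) (φ : M →ₗ[A] A) (h : φ x = 0) (q : M) :
    tvEquiv x φ h q = q + φ q • x := by
  simp [tvEquiv]

theorem Red.trans_group {a : A} {p : P} (h : Red (⊥ : Ideal A) a p) :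
    ∃ σ ∈ TransvectionGroup A (A × P), σ (a, p) = (1, 0) := by
  induction h with
  | @base a p h1 h2 =>
    refine ⟨1, one_mem _, ?_⟩
    have e1 : a = 1 := sub_eq_zero.1 h1
    have e2 : p = 0 := by simpa using h2
    rw [e1, e2]; rfl
  | @add1 a p φ _ ih =>
    obtain ⟨σ, hσ, h⟩ := ih
    have h0 : (φ.comp (LinearMap.snd A A P)) (1, 0) = 0 := by simp
    refine ⟨σ * tvEquiv (1, 0) (φ.comp (LinearMap.snd A A P)) h0,
      mul_mem hσ (Subgroup.subset_closure ⟨_, _, h0, Or.inl ⟨LinearMap.fst A A P, rfl⟩, tvEquiv_apply _ _ h0⟩), ?_⟩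
    rw [LinearEquiv.mul_apply, tvEquiv_apply]
    refine Eq.trans (congrArg σ ?_) h
    simp
  | @add2 a p q _ ih =>
    obtain ⟨σ, hσ, h⟩ := ih
    have h0 : (LinearMap.fst A A P) (0, q) = 0 := by simp
    refine ⟨σ * tvEquiv (0, q) (LinearMap.fst A A P) h0,
      mul_mem hσ (Subgroup.subset_closure ⟨_, _, h0, Or.inr ⟨LinearMap.applyₗ (1, 0), by simp⟩, tvEquiv_apply _ _ h0⟩), ?_⟩
    rw [LinearEquiv.mul_apply, tvEquiv_apply]
    refine Eq.trans (congrArg σ ?_) h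
    simp

/-- approximate dual bases modulo `K` -/
structure DualData (K : Ideal A) (ι : Type*) [Fintype ι] [DecidableEq ι] (P : Type*) [AddCommGroup P] [Module A P] (τ : A) where
  e : ι → P
  es : ι → P →ₗ[A] A
  dual : ∀ i j, es i (e j) - (if i = j then τ else 0) ∈ K
  sum : ∀ p : P, τ • p - ∑ i, es i p • e i ∈ (K • ⊤ : Submodule A P)

namespace DualData
variable {K : Ideal A} {ι : Type*} [Fintype ι] [DecidableEq ι] {τ : A} (D : DualData K ι P τ)

noncomputable def E : (ι → A) →ₗ[A] P := Fintype.linearCombination A D.e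
noncomputable def Es : P →ₗ[A] (ι → A) := LinearMap.pi D.es

theorem E_apply (v : ι → A) : D.E v = ∑ i, v i • D.e i := rfl

variable {B : Type*} [CommRing B] {π : A →+* B}

theorem E_mem (hπ : RingHom.ker π = K) {v : ι → A} (h : π ∘ v = 0) : D.E v ∈ (K • ⊤ : Submodule A P) := by
  rw [E_apply]
  refine sum_mem fun i _ => Submodule.smul_mem_smul ?_ trivial
  rw [← hπ, RingHom.mem_ker]; exact congrFun h i

theorem EsE (hπ : RingHom.ker π = K) (v : ι → A) : π ∘ (D.Es (D.E v)) = π τ • (π ∘ v) := by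
  funext i
  have h1 : ∀ j, π (D.es i (D.e j)) = if i = j then π τ else 0 := by
    intro j
    have := D.dual i j
    have this := (le_of_eq hπ.symm) this
    rw [RingHom.mem_ker, map_sub, sub_eq_zero] at this
    rw [this]; split_ifs <;> simp
  have h2 : D.Es (D.E v) i = ∑ j, v j * D.es i (D.e j) := by
    show D.es i (D.E v) = _
    rw [E_apply, map_sum]
    simp
  rw [Function.comp_apply, h2, map_sum]
  simp only [map_mul, h1, mul_ite, mul_zero, Finset.sum_ite_eq, Finset.mem_univ, if_true, Pi.smul_apply,
    Function.comp_apply, smul_eq_mul]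
  rw [mul_comm]

noncomputable def DM (M : Matrix ι ι A) : P →ₗ[A] P := D.E.comp (M.mulVecLin.comp D.Es)

theorem DM_apply (M : Matrix ι ι A) (p : P) : D.DM M p = D.E (M.mulVec (D.Es p)) := rfl

theorem comp_mulVec (π : A →+* B) (M : Matrix ι ι A) (v : ι → A) : π ∘ (M.mulVec v) = (M.map π).mulVec (π ∘ v) := by
  funext i; exact RingHom.map_mulVec π M v i

theorem comp_add (π : A →+* B) (v w : ι → A) : π ∘ (v + w) = π ∘ v + π ∘ w := by
  funext i; simp

theorem inv_aux (hπ : RingHom.ker π = K) (M N : Matrix ι ι A) (h : M.map π + N.map π + π τ • (N.map π * M.map π) = 0) (p : P) :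
    (LinearMap.id + D.DM N : P →ₗ[A] P) ((LinearMap.id + D.DM M : P →ₗ[A] P) p) - p ∈ (K • ⊤ : Submodule A P) := by
  have e1 : (LinearMap.id + D.DM N : P →ₗ[A] P) ((LinearMap.id + D.DM M : P →ₗ[A] P) p) - p =
      D.E (M.mulVec (D.Es p) + N.mulVec (D.Es p) + N.mulVec (D.Es (D.E (M.mulVec (D.Es p))))) := by
    simp only [LinearMap.add_apply, LinearMap.id_apply, DM_apply, map_add, Matrix.mulVec_add]
    abel
  rw [e1]
  refine D.E_mem hπ ?_
  rw [comp_add, comp_add, comp_mulVec, comp_mulVec, comp_mulVec, D.EsE hπ, comp_mulVec, Matrix.mulVec_smul, Matrix.mulVec_mulVec,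
    ← Matrix.smul_mulVec, ← Matrix.add_mulVec, ← Matrix.add_mulVec, h, Matrix.zero_mulVec]

theorem transfer (hπ : RingHom.ker π = K) (hs : Function.Surjective π) {a a' : B} {f f' : ι → B} (h : RelL (π τ) a f a' f')
    (ha' : a' = 1) (hf' : f' = 0) : ∀ (x : A) (v : ι → A), π x = a → π ∘ v = f → Red K x (D.E v) := by
  induction h with
  | refl a f =>
    intro x v hx hv
    refine Red.base ?_ (D.E_mem hπ (hv.trans hf'))
    rw [← hπ, RingHom.mem_ker, map_sub, hx, ha', map_one, sub_self]
  | @s1 a f _ _ φ _ ih =>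
    intro x v hx hv
    choose s hs' using hs
    refine Red.add1 (∑ i, s (φ i) • D.es i) (ih ha' hf' _ v ?_ hv)
    have e1 : (∑ i, s (φ i) • D.es i) (D.E v) = (s ∘ φ) ⬝ᵥ D.Es (D.E v) := by
      simp [LinearMap.sum_apply, dotProduct, Es]
    have e2 : π ∘ (s ∘ φ) = φ := by funext i; exact hs' _
    rw [e1, map_add, hx, RingHom.map_dotProduct, D.EsE hπ, hv, e2, dotProduct_smul, smul_eq_mul]
  | @s2 a f _ _ q _ ih =>
    intro x v hx hv
    choose s hs' using hs
    refine Red.add2 (D.E (s ∘ q)) ?_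
    rw [← map_smul, ← map_add]
    refine ih ha' hf' x _ hx ?_
    rw [comp_add, hv, ← hx]
    congr 1
    funext i; simp [hs']
  | @s3 a f _ _ M N h1 h2 _ ih =>
    intro x v hx hv
    choose s hs' using hs
    have eM : (M.map s).map π = M := by ext i j; simp [hs']
    have eN : (N.map s).map π = N := by ext i j; simp [hs']
    refine Red.transport' (LinearMap.id + D.DM (M.map s)) (LinearMap.id + D.DM (N.map s)) (D.inv_aux hπ _ _ ?_)
      (D.inv_aux hπ _ _ ?_) ?_
    · rw [eM, eN, ← h1]; abel
    · rw [eM, eN, ← h2]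
    · rw [LinearMap.add_apply, LinearMap.id_apply, DM_apply, ← map_add]
      refine ih ha' hf' x _ hx ?_
      rw [comp_add, comp_mulVec, D.EsE hπ, eM, hv, Matrix.mulVec_smul]

end DualData
end RedSec



section MainSec
open LaurentPolynomial
variable {R : Type*} [CommRing R] {P : Type*} [AddCommGroup P] [Module R[T;T⁻¹] P]

theorem main_step {r : ℕ} (hr : 1 ≤ r) {I : Ideal R} {τ : R}
    (hτ : Ideal.Quotient.mk I τ ∈ nonZeroDivisors (R ⧸ I))
    (D : DualData (I.map (LaurentPolynomial.C : R →+* R[T;T⁻¹])) (Fin r) P (LaurentPolynomial.C τ))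
    (hd : ringKrullDim (R ⧸ I) < r) {a : R[T;T⁻¹]} {p : P}
    (hu : Red.Um (I.map (LaurentPolynomial.C : R →+* R[T;T⁻¹])) a p)
    (hred : Red ((I ⊔ Ideal.span {τ}).map (LaurentPolynomial.C : R →+* R[T;T⁻¹])) a p) :
    Red (I.map (LaurentPolynomial.C : R →+* R[T;T⁻¹])) a p := by
  obtain ⟨a', p', h1, h2, ⟨x0, ψ, h3⟩, h4⟩ := hred.lift hu
  apply h4
  clear h4 hred hu
  rw [Ideal.map_sup, Ideal.map_span, Set.image_singleton] at h1 h2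
  set K := I.map (LaurentPolynomial.C : R →+* R[T;T⁻¹]) with hK
  obtain ⟨k, hk, w, hw, hkw⟩ := Submodule.mem_sup.1 h1
  obtain ⟨c, rfl⟩ := Ideal.mem_span_singleton'.1 hw
  rw [Submodule.sup_smul] at h2
  obtain ⟨p1, hp1, w', hw', hpw⟩ := Submodule.mem_sup.1 h2
  rw [Submodule.ideal_span_singleton_smul] at hw'
  obtain ⟨p2, -, rfl⟩ := hw'
  have hpw : p1 + (LaurentPolynomial.C τ : R[T;T⁻¹]) • p2 = p' := hpw
  have hker : RingHom.ker (lmap (Ideal.Quotient.mk I)) = K := ker_lmap I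
  have hsum : (LaurentPolynomial.C τ : R[T;T⁻¹]) • p2 - D.E (D.Es p2) ∈ (K • ⊤ : Submodule R[T;T⁻¹] P) := D.sum p2
  have hpE : D.E (D.Es p2) - p' ∈ (K • ⊤ : Submodule R[T;T⁻¹] P) := by
    rw [← hpw]
    convert neg_mem (add_mem hp1 hsum) using 1
    abel
  have haE : (1 + c * LaurentPolynomial.C τ) - a' ∈ K := by
    convert neg_mem hk using 1
    linear_combination hkw
  refine Red.congr (D.transfer hker (lmap_surj _ Ideal.Quotient.mk_surjective)
    (a := lmap (Ideal.Quotient.mk I) (1 + c * LaurentPolynomial.C τ))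
    (f := lmap (Ideal.Quotient.mk I) ∘ (D.Es p2)) ?_ rfl rfl (1 + c * LaurentPolynomial.C τ) (D.Es p2) rfl rfl)
    haE hpE
  rw [lmap_C]
  refine core_all hr hd hτ ?_ ?_
  · rw [map_add, map_one, map_mul, lmap_C, add_sub_cancel_left]; exact dvd_mul_left _ _
  · rw [Ideal.eq_top_iff_one]
    have e1 : lmap (Ideal.Quotient.mk I) (x0 * (1 + c * LaurentPolynomial.C τ) + ψ (D.E (D.Es p2))) = 1 := by
      have h5 : (x0 * (1 + c * LaurentPolynomial.C τ) + ψ (D.E (D.Es p2))) - 1 ∈ K := by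
        have h6 := map_smul_top' ψ hpE
        rw [map_sub] at h6
        convert add_mem (add_mem (K.mul_mem_left x0 haE) h6) h3 using 1
        ring
      have h7 := (le_of_eq hker.symm) h5
      rw [RingHom.mem_ker, map_sub, map_one, sub_eq_zero] at h7
      exact h7
    have e2 : lmap (Ideal.Quotient.mk I) (x0 * (1 + c * LaurentPolynomial.C τ) + ψ (D.E (D.Es p2))) =
        lmap (Ideal.Quotient.mk I) x0 * lmap (Ideal.Quotient.mk I) (1 + c * LaurentPolynomial.C τ) +
        ∑ i, lmap (Ideal.Quotient.mk I) (D.Es p2 i) * lmap (Ideal.Quotient.mk I) (ψ (D.e i)) := by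
      rw [DualData.E_apply, map_add, map_mul, map_sum, map_sum]
      congr 1
      refine Finset.sum_congr rfl fun i _ => ?_
      rw [map_smul, smul_eq_mul, map_mul]
    rw [← e1, e2]
    exact add_mem (Ideal.mul_mem_left _ _ (RelL.a_mem_idl _ _))
      (Ideal.sum_mem _ fun i _ => Ideal.mul_mem_right _ _ (RelL.f_mem_idl _ _ i))

theorem red_all {r : ℕ} (hr : 1 ≤ r) (hdata : ∀ I : Ideal R, I ≠ ⊤ → ∃ τ : R,
      Ideal.Quotient.mk I τ ∈ nonZeroDivisors (R ⧸ I) ∧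
      Nonempty (DualData (I.map (LaurentPolynomial.C : R →+* R[T;T⁻¹])) (Fin r) P (LaurentPolynomial.C τ))) :
    ∀ n : ℕ, n ≤ r → ∀ I : Ideal R, ringKrullDim (R ⧸ I) < n → ∀ (a : R[T;T⁻¹]) (p : P),
      Red.Um (I.map (LaurentPolynomial.C : R →+* R[T;T⁻¹])) a p →
      Red (I.map (LaurentPolynomial.C : R →+* R[T;T⁻¹])) a p := by
  intro n
  induction n with
  | zero =>
    intro _ I hd a p _
    have hI : I = ⊤ := by
      by_contra h
      haveI : Nontrivial (R ⧸ I) := Ideal.Quotient.nontrivial_iff.2 h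
      exact absurd hd (not_lt.2 (by simpa using ringKrullDim_nonneg_of_nontrivial))
    rw [hI, Ideal.map_top]
    exact Red.base trivial (by simp)
  | succ n ih =>
    intro hn I hd a p hu
    by_cases hI : I = ⊤
    · rw [hI, Ideal.map_top]
      exact Red.base trivial (by simp)
    obtain ⟨τ, hτ, ⟨D⟩⟩ := hdata I hI
    refine main_step hr hτ D (hd.trans_le (by exact_mod_cast hn)) hu (ih (by omega) _ ?_ a p ?_)
    · have h1 := ringKrullDim_quotient_succ_le_of_nonZeroDivisor hτ
      have h2 : ringKrullDim (R ⧸ I ⊔ Ideal.span {τ}) =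
          ringKrullDim ((R ⧸ I) ⧸ Ideal.span {Ideal.Quotient.mk I τ}) := by
        rw [← Set.image_singleton, ← Ideal.map_span]
        exact (ringKrullDim_eq_of_ringEquiv (DoubleQuot.quotQuotEquivQuotSup I (Ideal.span {τ}))).symm
      rw [h2]
      by_contra hcon
      rw [not_lt] at hcon
      have h3 := (add_le_add_left hcon 1).trans h1
      have h4 := h3.trans_lt hd
      simp at h4
    · obtain ⟨x, ψ, h⟩ := hu
      exact ⟨x, ψ, Ideal.map_mono le_sup_left h⟩

end MainSec


section DualSec
variable {A : Type*} [CommRing A] {P : Type*} [AddCommGroup P] [Module A P]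

noncomputable def quotEquivB (K : Ideal A) :
    TensorProduct A (A ⧸ K) P ≃ₗ[A ⧸ K] (P ⧸ (K • ⊤ : Submodule A P)) :=
  LinearEquiv.extendScalarsOfSurjective (R := A) (Ideal.Quotient.mk_surjective) (TensorProduct.quotTensorEquivQuotSMul P K)

theorem quot_projective [Module.Projective A P] (K : Ideal A) :
    Module.Projective (A ⧸ K) (P ⧸ (K • ⊤ : Submodule A P)) :=
  Module.Projective.of_equiv (quotEquivB K)

theorem quot_finite [Module.Finite A P] (K : Ideal A) :
    Module.Finite (A ⧸ K) (P ⧸ (K • ⊤ : Submodule A P)) :=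
  Module.Finite.equiv (quotEquivB K)

theorem rank_eq [Module.Finite A P] [Module.Projective A P] {r : ℕ} (hrank : HasConstantRank A P r)
    (K : Ideal A) (S : Submonoid (A ⧸ K)) [Nontrivial (Localization S)]
    [Module.Free (Localization S) (LocalizedModule S (P ⧸ (K • ⊤ : Submodule A P)))] :
    Module.finrank (Localization S) (LocalizedModule S (P ⧸ (K • ⊤ : Submodule A P))) = r := by
  haveI := quot_projective (P := P) K
  haveI := quot_finite (P := P) K
  obtain ⟨q⟩ : Nonempty (PrimeSpectrum (Localization S)) := inferInstance
  haveI : Module.Finite (Localization S) (LocalizedModule S (P ⧸ (K • ⊤ : Submodule A P))) := inferInstance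
  have h1 := congrFun (Module.rankAtStalk_eq_finrank_of_free (R := Localization S)
    (M := LocalizedModule S (P ⧸ (K • ⊤ : Submodule A P)))) q
  have h2 := Module.rankAtStalk_isBaseChange (LocalizedModule.isBaseChange (M := P ⧸ (K • ⊤ : Submodule A P)) S) q
  have h3 := Module.rankAtStalk_baseChange (R := A) (M := P) (S := A ⧸ K) (PrimeSpectrum.comap (algebraMap (A ⧸ K) (Localization S)) q)
  have h4 := congrFun (Module.rankAtStalk_eq_of_equiv (quotEquivB (P := P) K)) (PrimeSpectrum.comap (algebraMap (A ⧸ K) (Localization S)) q)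
  rw [h4, ← h2, h1] at h3
  simp at h3
  rw [h3]
  exact (hrank _ _).2

theorem dual_B {B M : Type*} [CommRing B] [AddCommGroup M] [Module B M] [Module.Finite B M]
    [Module.Projective B M] {s : B} (hs : s ∈ nonZeroDivisors B) {ι : Type*} [Fintype ι] [DecidableEq ι]
    (b : Module.Basis ι (Localization (Submonoid.powers s)) (LocalizedModule (Submonoid.powers s) M)) :
    ∃ (k : ℕ) (e : ι → M) (es : ι → M →ₗ[B] B), (∀ i j, es i (e j) = if i = j then s ^ k else 0) ∧
      ∀ m, s ^ k • m = ∑ i, es i m • e i := by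
  classical
  set S := Submonoid.powers s with hS
  let L := Localization S
  let N := LocalizedModule S M
  let f : M →ₗ[B] N := LocalizedModule.mkLinearMap S M
  have hle : S ≤ nonZeroDivisors B := Submonoid.powers_le.2 hs
  haveI : Module.FinitePresentation B M :=
    Module.finitePresentation_of_projective B M
  have hx : ∀ i, ∃ (x : M) (n : ℕ), f x = s ^ n • b i := by
    intro i
    obtain ⟨⟨x, ⟨_, n, rfl⟩⟩, h⟩ := IsLocalizedModule.surj S f (b i)
    exact ⟨x, n, h.symm⟩
  choose x n hx using hx
  have hg : ∀ i, ∃ (g : M →ₗ[B] B) (m : ℕ), ∀ y, algebraMap B L (g y) = s ^ m • b.coord i (f y) := by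
    intro i
    obtain ⟨g, ⟨_, m, rfl⟩, h⟩ := Module.FinitePresentation.exists_lift_of_isLocalizedModule S
      (Algebra.linearMap B L) (((b.coord i).restrictScalars B) ∘ₗ f)
    exact ⟨g, m, fun y => LinearMap.congr_fun h y⟩
  choose g m hg using hg
  have hinj : Function.Injective (algebraMap B L) := IsLocalization.injective L hle
  have hfinj : Function.Injective f := by
    rw [injective_iff_map_eq_zero]
    intro y hy
    obtain ⟨c, hc⟩ := (IsLocalizedModule.eq_zero_iff S f).1 hy
    exact Module.Flat.isSMulRegular_of_nonZeroDivisors (hle c.2) (hc.trans (smul_zero _).symm)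
  let k := ∑ i, (n i + m i)
  have hk : ∀ i, n i + m i ≤ k := fun i =>
    Finset.single_le_sum (f := fun i => n i + m i) (fun _ _ => Nat.zero_le _) (Finset.mem_univ i)
  have hes : ∀ i y, algebraMap B L (s ^ (k - (n i + m i)) * g i y) =
      s ^ (k - n i) • b.coord i (f y) := by
    intro i y
    rw [map_mul, hg, ← Algebra.smul_def, smul_smul, ← pow_add]
    congr 2
    have := hk i
    omega
  refine ⟨k, x, fun i => s ^ (k - (n i + m i)) • g i, ?_, ?_⟩
  · intro i j
    apply hinj
    rw [LinearMap.smul_apply, smul_eq_mul, hes, hx, LinearMap.map_smul_of_tower]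
    rw [Module.Basis.coord_apply, Module.Basis.repr_self, Finsupp.single_apply]
    by_cases hij : i = j
    · subst hij
      rw [if_pos rfl, if_pos rfl, smul_smul, ← pow_add, Algebra.smul_def, mul_one]
      congr 2
      have := hk i
      omega
    · rw [if_neg hij, if_neg (Ne.symm hij), smul_zero, smul_zero, map_zero]
  · intro y
    apply hfinj
    rw [map_smul, map_sum]
    have h1 : f y = ∑ i, b.coord i (f y) • b i := (b.sum_repr (f y)).symm
    conv_lhs => rw [h1, Finset.smul_sum]
    refine Finset.sum_congr rfl fun i _ => ?_
    rw [map_smul, hx, LinearMap.smul_apply, smul_eq_mul, ← algebraMap_smul L (s ^ (k - (n i + m i)) * g i y), hes,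
      smul_assoc, smul_comm (b.coord i (f y)), smul_smul, ← pow_add]
    congr 2
    have := hk i
    omega

theorem dual_A [Module.Finite A P] [Module.Projective A P] {r : ℕ} (hrank : HasConstantRank A P r)
    {K : Ideal A} (hK : K ≠ ⊤) {s : A} (hs : Ideal.Quotient.mk K s ∈ nonZeroDivisors (A ⧸ K))
    (hfree : Module.Free (Localization (Submonoid.powers (Ideal.Quotient.mk K s)))
      (LocalizedModule (Submonoid.powers (Ideal.Quotient.mk K s)) (P ⧸ (K • ⊤ : Submodule A P)))) :
    ∃ k : ℕ, Nonempty (DualData K (Fin r) P (s ^ k)) := by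
  classical
  haveI := quot_projective (P := P) K
  haveI := quot_finite (P := P) K
  haveI : Nontrivial (A ⧸ K) := Ideal.Quotient.nontrivial_iff.2 hK
  haveI : Nontrivial (Localization (Submonoid.powers (Ideal.Quotient.mk K s))) :=
    (IsLocalization.injective (Localization (Submonoid.powers (Ideal.Quotient.mk K s)))
      (Submonoid.powers_le.2 hs)).nontrivial
  have hr := rank_eq hrank K (Submonoid.powers (Ideal.Quotient.mk K s))
  obtain ⟨k, e, es, h1, h2⟩ := dual_B hs (Module.finBasisOfFinrankEq _ _ hr)
  have he : ∀ i, ∃ p : P, Submodule.Quotient.mk (p := (K • ⊤ : Submodule A P)) p = e i :=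
    fun i => Submodule.Quotient.mk_surjective _ _
  choose e' he' using he
  have hes : ∀ i, ∃ g : P →ₗ[A] A, ∀ p, Ideal.Quotient.mk K (g p) =
      es i (Submodule.Quotient.mk (p := (K • ⊤ : Submodule A P)) p) := by
    intro i
    obtain ⟨g, hg⟩ := Module.projective_lifting_property (Submodule.mkQ K)
      ((es i).restrictScalars A ∘ₗ Submodule.mkQ (K • ⊤ : Submodule A P)) (Submodule.mkQ_surjective _)
    exact ⟨g, fun p => LinearMap.congr_fun hg p⟩
  choose g hg using hes
  refine ⟨k, ⟨⟨e', g, ?_, ?_⟩⟩⟩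
  · intro i j
    rw [← Ideal.Quotient.eq, hg, he', h1]
    split_ifs <;> simp
  · intro p
    rw [← Submodule.Quotient.eq, Submodule.Quotient.mk_smul, ← Submodule.mkQ_apply, ← Submodule.mkQ_apply, map_sum]
    have h3 := h2 (Submodule.Quotient.mk (p := (K • ⊤ : Submodule A P)) p)
    rw [← map_pow] at h3
    refine Eq.trans h3 (Finset.sum_congr rfl fun i _ => ?_)
    rw [← hg, ← he']
    rfl

end DualSec

section OmegaSec
open LaurentPolynomial

theorem hdata_of_omega {R : Type*} [CommRing R] {P : Type*} [AddCommGroup P] [Module R[T;T⁻¹] P]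
    [Module.Finite R[T;T⁻¹] P] [Module.Projective R[T;T⁻¹] P] {r : ℕ}
    (hrank : HasConstantRank R[T;T⁻¹] P r) (hΩ : PropertyOmega R R[T;T⁻¹] P)
    (I : Ideal R) (hI : I ≠ ⊤) : ∃ τ : R,
      Ideal.Quotient.mk I τ ∈ nonZeroDivisors (R ⧸ I) ∧
      Nonempty (DualData (I.map (LaurentPolynomial.C : R →+* R[T;T⁻¹])) (Fin r) P (LaurentPolynomial.C τ)) := by
  obtain ⟨t, ht, hfree⟩ := hΩ I
  have hK : I.map (LaurentPolynomial.C : R →+* R[T;T⁻¹]) ≠ ⊤ := by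
    intro h
    have h1 : (1 : R[T;T⁻¹]) ∈ I.map (LaurentPolynomial.C : R →+* R[T;T⁻¹]) := h ▸ trivial
    have h2 := mem_map_C_iff.1 h1 0
    apply hI
    rw [Ideal.eq_top_iff_one]
    have h3 : (1 : R[T;T⁻¹]).coeff 0 = 1 := by
      rw [AddMonoidAlgebra.one_def, AddMonoidAlgebra.coeff_single, Finsupp.single_eq_same]
    rwa [h3] at h2
  have hs : Ideal.Quotient.mk (I.map (LaurentPolynomial.C : R →+* R[T;T⁻¹])) (LaurentPolynomial.C t) ∈
      nonZeroDivisors (R[T;T⁻¹] ⧸ I.map (LaurentPolynomial.C : R →+* R[T;T⁻¹])) := by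
    rw [mem_nonZeroDivisors_iff_right]
    intro x hx
    obtain ⟨x, rfl⟩ := Ideal.Quotient.mk_surjective x
    rw [← map_mul, Ideal.Quotient.eq_zero_iff_mem, mem_map_C_iff] at hx
    rw [Ideal.Quotient.eq_zero_iff_mem, mem_map_C_iff]
    intro n
    have h1 := hx n
    rw [mul_comm, ← LaurentPolynomial.smul_eq_C_mul, AddMonoidAlgebra.coeff_smul] at h1
    rw [← Ideal.Quotient.eq_zero_iff_mem] at h1 ⊢
    refine (mem_nonZeroDivisors_iff_right.1 ht) _ ?_
    rw [← map_mul, mul_comm]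
    exact h1
  obtain ⟨k, ⟨D⟩⟩ := dual_A hrank hK hs hfree
  refine ⟨t ^ k, by rw [map_pow]; exact pow_mem ht k, ⟨?_⟩⟩
  rw [map_pow]
  exact D

end OmegaSec


/-- Let `R` be a commutative ring of finite Krull dimension `d` and
`A = R[Y, Y⁻¹]` the Laurent polynomial ring in one variable. If `P` is a finitely generated
projective `A`-module of constant rank `r ≥ d + 1` satisfying property `Ω(R)`, then
`E(A ⊕ P)` acts transitively on `Um(A ⊕ P)`. -/
theorem statement_4 (R : Type*) [CommRing R] (d : ℕ) (hdim : ringKrullDim R = d)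
    (P : Type*) [AddCommGroup P] [Module (LaurentPolynomial R) P]
    [Module.Finite (LaurentPolynomial R) P] [Module.Projective (LaurentPolynomial R) P]
    (r : ℕ) (hr : d + 1 ≤ r) (hrank : HasConstantRank (LaurentPolynomial R) P r)
    (hΩ : PropertyOmega R (LaurentPolynomial R) P) :
    ∀ v w : LaurentPolynomial R × P,
      IsUnimodular (LaurentPolynomial R) (LaurentPolynomial R × P) v →
      IsUnimodular (LaurentPolynomial R) (LaurentPolynomial R × P) w →
      ∃ σ ∈ TransvectionGroup (LaurentPolynomial R) (LaurentPolynomial R × P), σ v = w := by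
  have hr1 : 1 ≤ r := by omega
  have key : ∀ v : LaurentPolynomial R × P,
      IsUnimodular (LaurentPolynomial R) (LaurentPolynomial R × P) v →
      ∃ σ ∈ TransvectionGroup (LaurentPolynomial R) (LaurentPolynomial R × P), σ v = (1, 0) := by
    rintro ⟨a, p⟩ ⟨φ, hφ⟩
    have h1 := red_all hr1 (hdata_of_omega hrank hΩ) r le_rfl (⊥ : Ideal R) (by
      rw [ringKrullDim_eq_of_ringEquiv (RingEquiv.quotientBot R), hdim]
      exact_mod_cast hr) a p ?_
    · rw [Ideal.map_bot] at h1
      exact h1.trans_group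
    · refine ⟨φ (1, 0), φ ∘ₗ LinearMap.inr _ _ _, ?_⟩
      have h2 : φ (1, 0) * a + (φ ∘ₗ LinearMap.inr _ _ _) p - 1 = 0 := by
        rw [sub_eq_zero]
        refine Eq.trans ?_ hφ
        rw [mul_comm, ← smul_eq_mul, ← map_smul, LinearMap.comp_apply, ← map_add]
        simp
      rw [h2]
      exact zero_mem _
  intro v w hv hw
  obtain ⟨σ, hσ, h1⟩ := key v hv
  obtain ⟨ρ, hρ, h2⟩ := key w hw
  refine ⟨ρ⁻¹ * σ, mul_mem (inv_mem hρ) hσ, ?_⟩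
  rw [LinearEquiv.mul_apply, h1, ← h2]
  exact ρ.symm_apply_apply w
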